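/- arXiv:1804.03466 — 3 statements merged into one kernel-verified Lean document; each statement's English description precedes it below -/
import Mathlib

section
/- Let β ∈ {1,2} and let B^n_{∞,β} = {A ∈ H_n(F_β) : max_{1≤j≤n} |λ_j(A)| ≤ 1} be the operator-norm unit ball. Then lim_{n→∞} n^{1/2} · vol_{β,n}(B^n_{∞,β})^{2/(β n²)} = (π/β)^{1/2} · e^{3/4}. -/
open MeasureTheory Filter ENNReal Matrix
open scoped RealInnerProductSpace

set_option maxHeartbeats 1000000
set_option autoImplicit false
set_option synthInstance.maxHeartbeats 1000000

noncomputable section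

instance rclikeStarModule (𝕜 : Type) [RCLike 𝕜] : StarModule ℝ 𝕜 :=
  ⟨fun r a => by
    simp [Algebra.smul_def, StarMul.star_mul, RCLike.star_def, RCLike.conj_ofReal, mul_comm]⟩

instance matrixMeasurableSpace {𝕜 : Type} [MeasurableSpace 𝕜] (n : ℕ) :
    MeasurableSpace (Matrix (Fin n) (Fin n) 𝕜) :=
  inferInstanceAs (MeasurableSpace (Fin n → Fin n → 𝕜))

/-- The space `H_n(F_β)` of self-adjoint `n × n` matrices over `𝕜 = F_β`. -/
abbrev HMat (𝕜 : Type) [RCLike 𝕜] (n : ℕ) := selfAdjoint (Matrix (Fin n) (Fin n) 𝕜)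

/-- The real eigenvalues (with multiplicity, in some order) of a self-adjoint matrix. -/
def eigs {𝕜 : Type} [RCLike 𝕜] {n : ℕ} (A : HMat 𝕜 n) : Fin n → ℝ :=
  Matrix.IsHermitian.eigenvalues A.prop

/-- The operator-norm unit ball `B^n_{∞,β} = {A : max_j |λ_j(A)| ≤ 1}`. -/
def matBallInf (𝕜 : Type) [RCLike 𝕜] (n : ℕ) : Set (HMat 𝕜 n) :=
  {A | ∀ j, |eigs A j| ≤ 1}

theorem sub_mul_log_le {x y : ℝ} (hx : 0 < x) (hy : 0 < y) :
    (y - x) * Real.log x ≤ (y * Real.log y - y) - (x * Real.log x - x) := by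
  have h := Real.one_sub_inv_le_log_of_pos (div_pos hy hx)
  rw [Real.log_div hy.ne' hx.ne', inv_div] at h
  have h2 := mul_le_mul_of_nonneg_left h hy.le
  have h3 : y * (1 - x / y) = y - x := by field_simp
  rw [h3] at h2
  linarith

theorem tendsto_log_factorial_sub_div :
    Tendsto (fun n : ℕ => (Real.log n.factorial - (n * Real.log n - n)) / n) atTop (nhds 0) := by
  have h1 : Tendsto (fun n : ℕ => Real.log (Stirling.stirlingSeq n) / (n : ℝ)) atTop (nhds 0) :=
    ((Real.continuousAt_log (by positivity)).tendsto.comp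
      Stirling.tendsto_stirlingSeq_sqrt_pi).div_atTop tendsto_natCast_atTop_atTop
  have h2 : Tendsto (fun n : ℕ => Real.log (2 * n) / (2 * n : ℝ)) atTop (nhds 0) :=
    (Real.isLittleO_log_id_atTop.tendsto_div_nhds_zero).comp
      (tendsto_natCast_atTop_atTop.const_mul_atTop (by norm_num : (0 : ℝ) < 2))
  have h3 := h1.add h2
  rw [add_zero] at h3
  refine h3.congr' ?_
  filter_upwards [eventually_gt_atTop 0] with n hn
  have hn' : (0 : ℝ) < n := by exact_mod_cast hn
  rw [Stirling.log_stirlingSeq_formula, Real.log_div hn'.ne' (Real.exp_pos 1).ne', Real.log_exp]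
  field_simp
  ring

/-- A crude form of Stirling's formula for the Gamma function. -/
theorem tendsto_log_Gamma_sub_div :
    Tendsto (fun x : ℝ => (Real.log (Real.Gamma (1 + x)) - (x * Real.log x - x)) / x)
      atTop (nhds 0) := by
  set e : ℕ → ℝ := fun n => Real.log n.factorial - (n * Real.log n - n) with he
  have hfl : Tendsto (fun x : ℝ => ⌊x⌋₊) atTop atTop := tendsto_nat_floor_atTop
  have hlog : Tendsto (fun n : ℕ => Real.log (n + 1) / (n : ℝ)) atTop (nhds 0) := by
    have h1 : Tendsto (fun n : ℕ => Real.log n / (n : ℝ)) atTop (nhds 0) :=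
      (Real.isLittleO_log_id_atTop.tendsto_div_nhds_zero).comp tendsto_natCast_atTop_atTop
    have h2 : Tendsto (fun n : ℕ => (Real.log (n + 1) - Real.log n) / (n : ℝ)) atTop (nhds 0) :=
      Real.tendsto_log_nat_add_one_sub_log.div_atTop tendsto_natCast_atTop_atTop
    have h3 := h1.add h2
    rw [add_zero] at h3
    refine h3.congr fun n => ?_
    ring
  have hup : Tendsto (fun n : ℕ => (|e n| + |e (n + 1)| + Real.log (n + 1)) / (n : ℝ))
      atTop (nhds 0) := by
    have h1 := tendsto_log_factorial_sub_div.abs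
    have h2 := ((tendsto_add_atTop_iff_nat 1).2 tendsto_log_factorial_sub_div).abs
    have h4 : Tendsto (fun n : ℕ => ((n + 1 : ℕ) : ℝ) / (n : ℝ)) atTop (nhds 1) := by
      have := tendsto_one_div_atTop_nhds_zero_nat (𝕜 := ℝ) |>.const_add 1
      rw [add_zero] at this
      refine this.congr' ?_
      filter_upwards [eventually_gt_atTop 0] with n hn
      have hn' : (0 : ℝ) < n := by exact_mod_cast hn
      push_cast
      field_simp
    have h5 := (h1.add (h2.mul h4)).add hlog
    simp only [abs_zero, zero_mul, add_zero] at h5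
    refine h5.congr' ?_
    filter_upwards [eventually_gt_atTop 0] with n hn
    have hn' : (0 : ℝ) < n := by exact_mod_cast hn
    have hn'' : (0 : ℝ) < ((n + 1 : ℕ) : ℝ) := by positivity
    rw [abs_div, abs_div, abs_of_pos hn', abs_of_pos hn'', he]
    field_simp
  refine squeeze_zero_norm' ?_ (hup.comp hfl)
  filter_upwards [eventually_ge_atTop 1] with x hx
  have hx0 : 0 < x := by linarith
  set n := ⌊x⌋₊ with hn
  have hn1 : 1 ≤ n := Nat.le_floor (by simpa using hx)
  have hn1' : (1 : ℝ) ≤ n := by exact_mod_cast hn1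
  have hn0 : (0 : ℝ) < n := by linarith
  have hnx : (n : ℝ) ≤ x := Nat.floor_le hx0.le
  have hxn : x ≤ n + 1 := (Nat.lt_floor_add_one x).le
  have g1 : Real.log n.factorial ≤ Real.log (Real.Gamma (1 + x)) := by
    rw [← Real.Gamma_nat_eq_factorial]
    refine Real.log_le_log (Real.Gamma_pos_of_pos (by positivity)) ?_
    exact Real.Gamma_strictMonoOn_Ici.monotoneOn (Set.mem_Ici.2 (by linarith))
      (Set.mem_Ici.2 (by linarith)) (by linarith)
  have g2 : Real.log (Real.Gamma (1 + x)) ≤ Real.log (n + 1).factorial := by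
    rw [← Real.Gamma_nat_eq_factorial]
    refine Real.log_le_log (Real.Gamma_pos_of_pos (by positivity)) ?_
    exact Real.Gamma_strictMonoOn_Ici.monotoneOn (Set.mem_Ici.2 (by linarith))
      (Set.mem_Ici.2 (by push_cast; linarith)) (by push_cast; linarith)
  have m1 := sub_mul_log_le hn0 hx0
  have m2 := sub_mul_log_le hx0 (by linarith : (0 : ℝ) < n + 1)
  have m3 := sub_mul_log_le (by linarith : (0 : ℝ) < n + 1) hn0
  have p1 : 0 ≤ (x - n) * Real.log n :=
    mul_nonneg (by linarith) (Real.log_nonneg hn1')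
  have p2 : 0 ≤ (n + 1 - x) * Real.log x :=
    mul_nonneg (by linarith) (Real.log_nonneg hx)
  have q1 : Real.log n.factorial = e n + (n * Real.log n - n) := by rw [he]; ring
  have q2 : Real.log (n + 1).factorial =
      e (n + 1) + ((n + 1) * Real.log (n + 1) - (n + 1)) := by rw [he]; push_cast; ring
  have a1 := neg_abs_le (e n)
  have a2 := le_abs_self (e (n + 1))
  have a3 := abs_nonneg (e n)
  have a4 := abs_nonneg (e (n + 1))
  have key : |Real.log (Real.Gamma (1 + x)) - (x * Real.log x - x)| ≤
      |e n| + |e (n + 1)| + Real.log (n + 1) := by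
    rw [abs_le]
    constructor <;> linarith
  rw [Real.norm_eq_abs, abs_div, abs_of_pos hx0]
  simp only [Function.comp]
  exact div_le_div₀ ((abs_nonneg _).trans key) key hn0 hnx

theorem tendsto_sum_range_div_sq {f : ℕ → ℝ}
    (h : Tendsto (fun k : ℕ => f k / k) atTop (nhds 0)) (h0 : f 0 = 0) :
    Tendsto (fun n : ℕ => (∑ k ∈ Finset.range n, f k) / (n : ℝ) ^ 2) atTop (nhds 0) := by
  have hs : ∀ n : ℕ, ∑ k ∈ Finset.range n, (k : ℝ) = n * (n - 1) / 2 := by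
    intro n
    induction n with
    | zero => simp
    | succ n ih => rw [Finset.sum_range_succ, ih]; push_cast; ring
  have ho : f =o[atTop] (fun k : ℕ => (k : ℝ)) := by
    rw [Asymptotics.isLittleO_iff_tendsto]
    · exact h
    · intro k hk
      have : k = 0 := by exact_mod_cast hk
      rw [this, h0]
  have h1 := ho.sum_range (fun k => Nat.cast_nonneg k) (by
    refine tendsto_atTop_mono' _ ?_ (tendsto_natCast_atTop_atTop (R := ℝ))
    filter_upwards [eventually_ge_atTop 3] with n hn
    have hn' : (3 : ℝ) ≤ n := by exact_mod_cast hn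
    rw [hs]
    nlinarith)
  have h2 : (fun n : ℕ => ∑ k ∈ Finset.range n, (k : ℝ)) =O[atTop] fun n : ℕ => (n : ℝ) ^ 2 := by
    refine Asymptotics.IsBigO.of_bound 1 (.of_forall fun n => ?_)
    rw [hs, Real.norm_eq_abs, Real.norm_eq_abs,
      abs_of_nonneg (by positivity : (0 : ℝ) ≤ (n : ℝ) ^ 2),
      abs_le]
    have h3 : (0 : ℝ) ≤ n := Nat.cast_nonneg n
    have h4 : (n : ℝ) ≤ (n : ℝ) ^ 2 := by exact_mod_cast Nat.le_self_pow two_ne_zero n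
    constructor <;> nlinarith
  exact (h1.trans_isBigO h2).tendsto_div_nhds_zero

/-- The sum `∑_{k < m} log Γ(1 + b k)`. -/
def logGammaSum (b : ℝ) (m : ℕ) : ℝ :=
  ∑ k ∈ Finset.range m, Real.log (Real.Gamma (1 + b * k))

/-- The leading order of `logGammaSum`. -/
def logGammaSumMain (b : ℝ) (m : ℕ) : ℝ :=
  b * ((m : ℝ) ^ 2 * Real.log m / 2 + (Real.log b / 2 - 3 / 4) * (m : ℝ) ^ 2)

theorem tendsto_log_Gamma_nat {b : ℝ} (hb : 0 < b) :
    Tendsto (fun k : ℕ => (Real.log (Real.Gamma (1 + b * k)) -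
      (b * k * Real.log (b * k) - b * k)) / k) atTop (nhds 0) := by
  have h := (tendsto_log_Gamma_sub_div.comp
    ((tendsto_natCast_atTop_atTop (R := ℝ)).const_mul_atTop hb)).mul_const b
  rw [zero_mul] at h
  refine h.congr fun k => ?_
  simp only [Function.comp]
  field_simp

theorem tendsto_logGammaSum_sub {b : ℝ} (hb : 0 < b) :
    Tendsto (fun m : ℕ => (logGammaSum b m - logGammaSumMain b m) / (m : ℝ) ^ 2)
      atTop (nhds 0) := by
  have hlog := Real.tendsto_log_nat_add_one_sub_log
  have hlog1 : Tendsto (fun n : ℕ => Real.log (n + 1) / (n : ℝ)) atTop (nhds 0) := by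
    have h1 : Tendsto (fun n : ℕ => Real.log n / (n : ℝ)) atTop (nhds 0) :=
      (Real.isLittleO_log_id_atTop.tendsto_div_nhds_zero).comp tendsto_natCast_atTop_atTop
    have h3 := h1.add (hlog.div_atTop tendsto_natCast_atTop_atTop)
    rw [add_zero] at h3
    exact h3.congr fun n => by ring
  have hmul : Tendsto (fun n : ℕ => n * (Real.log (n + 1) - Real.log n)) atTop (nhds 1) := by
    refine ((Real.tendsto_mul_log_one_add_div_atTop 1).comp
      (tendsto_natCast_atTop_atTop (R := ℝ))).congr' ?_
    filter_upwards [eventually_gt_atTop 0] with n hn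
    have hn' : (0 : ℝ) < n := by exact_mod_cast hn
    simp only [Function.comp]
    rw [← Real.log_div (by positivity) hn'.ne']
    congr 2
    field_simp
  have hone : Tendsto (fun n : ℕ => 1 / (n : ℝ)) atTop (nhds 0) :=
    tendsto_one_div_atTop_nhds_zero_nat
  set f : ℕ → ℝ := fun k => Real.log (Real.Gamma (1 + b * k)) -
    (logGammaSumMain b (k + 1) - logGammaSumMain b k) with hf
  have hsum : ∀ m, ∑ k ∈ Finset.range m, (f k - if k = 0 then f 0 else 0) =
      logGammaSum b m - logGammaSumMain b m - if m = 0 then 0 else f 0 := by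
    intro m
    rw [Finset.sum_sub_distrib, hf, Finset.sum_sub_distrib, Finset.sum_range_sub]
    rcases m with _ | m
    · simp [logGammaSum, logGammaSumMain]
    · simp [logGammaSum, logGammaSumMain]
  have hfk : Tendsto (fun k : ℕ => (f k - if k = 0 then f 0 else 0) / k) atTop (nhds 0) := by
    have h := (tendsto_log_Gamma_nat hb).sub
      ((((((hmul.const_add (-1)).add (hlog.const_mul 2)).add hlog1).const_mul (1 / 2)).add
        (hone.const_mul (Real.log b / 2 - 3 / 4))).const_mul b)
    simp only [neg_add_cancel, mul_zero, add_zero, sub_zero] at h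
    refine h.congr' ?_
    filter_upwards [eventually_gt_atTop 0] with k hk
    have hk' : (0 : ℝ) < k := by exact_mod_cast hk
    rw [if_neg hk.ne', hf]
    simp only [logGammaSumMain]
    rw [Real.log_mul hb.ne' hk'.ne']
    push_cast
    field_simp
    ring
  have h1 := tendsto_sum_range_div_sq hfk (by simp)
  have h2 : Tendsto (fun m : ℕ => f 0 / (m : ℝ) ^ 2) atTop (nhds 0) :=
    tendsto_const_nhds.div_atTop ((tendsto_pow_atTop two_ne_zero).comp
      (tendsto_natCast_atTop_atTop (R := ℝ)))
  have h3 := h1.add h2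
  rw [add_zero] at h3
  refine h3.congr' ?_
  filter_upwards [eventually_gt_atTop 0] with m hm
  rw [hsum, if_neg hm.ne']
  ring

theorem tendsto_log_Gamma_div_sq {b : ℝ} (hb : 0 < b) :
    Tendsto (fun k : ℕ => Real.log (Real.Gamma (1 + b * k)) / (k : ℝ) ^ 2) atTop (nhds 0) := by
  have hone : Tendsto (fun n : ℕ => 1 / (n : ℝ)) atTop (nhds 0) :=
    tendsto_one_div_atTop_nhds_zero_nat
  have h1 : Tendsto (fun n : ℕ => Real.log n / (n : ℝ)) atTop (nhds 0) :=
    (Real.isLittleO_log_id_atTop.tendsto_div_nhds_zero).comp tendsto_natCast_atTop_atTop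
  have h := (((tendsto_log_Gamma_nat hb).mul hone).add (h1.const_mul b)).add
    (hone.const_mul (b * Real.log b - b))
  simp only [mul_zero, add_zero] at h
  refine h.congr' ?_
  filter_upwards [eventually_gt_atTop 0] with k hk
  have hk' : (0 : ℝ) < k := by exact_mod_cast hk
  rw [Real.log_mul hb.ne' hk'.ne']
  field_simp
  ring

theorem tendsto_logGammaSum_add_sub {b : ℝ} (hb : 0 < b) {e : ℕ} (he : e ≤ 1) :
    Tendsto (fun m : ℕ => (logGammaSum b (m + e) - logGammaSumMain b m) / (m : ℝ) ^ 2)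
      atTop (nhds 0) := by
  interval_cases e
  · exact tendsto_logGammaSum_sub hb
  · have h := (tendsto_logGammaSum_sub hb).add (tendsto_log_Gamma_div_sq hb)
    rw [add_zero] at h
    refine h.congr fun m => ?_
    rw [logGammaSum, logGammaSum, Finset.sum_range_succ]
    ring

theorem tendsto_logGammaSum_combination {b : ℝ} (hb : 0 < b) {e : ℕ} (he : e ≤ 1) :
    Tendsto (fun n : ℕ => (2 * logGammaSum b n - logGammaSum b (2 * n + e) +
        logGammaSum b (n + e)) / (b * (n : ℝ) ^ 2) + Real.log n / 2)
      atTop (nhds (3 / 4 - Real.log b / 2 - 2 * Real.log 2)) := by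
  have h2n : Tendsto (fun n : ℕ => 2 * n) atTop atTop :=
    tendsto_id.const_mul_atTop' (by norm_num)
  have h := (((tendsto_logGammaSum_sub hb).const_mul (2 / b)).sub
    (((tendsto_logGammaSum_add_sub hb he).comp h2n).const_mul (4 / b))).add
    ((tendsto_logGammaSum_add_sub hb he).const_mul (1 / b))
  simp only [mul_zero, sub_zero, add_zero] at h
  have h' := h.add_const (3 / 4 - Real.log b / 2 - 2 * Real.log 2)
  rw [zero_add] at h'
  refine h'.congr' ?_
  filter_upwards [eventually_gt_atTop 0] with n hn
  have hn' : (0 : ℝ) < n := by exact_mod_cast hn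
  simp only [Function.comp, logGammaSumMain]
  push_cast
  rw [Real.log_mul two_ne_zero hn'.ne']
  field_simp
  ring

/-- The ratio of consecutive matrix Beta integrals, see
`lintegral_lintegral_detWeight_blockMat`. -/
def stepConst (b : ℝ) (n : ℕ) (a : ℝ) : ℝ :=
  2 ^ (2 * a + 1 + b * n) * Real.pi ^ (b * n) * Real.Gamma (a + 1) ^ 2 /
    Real.Gamma (2 * a + 2 + b * n)

/-- The value of the matrix Beta integral `∫ det(1 + A)^a det(1 - A)^a` over `-1 < A < 1`. -/
def matBeta (b : ℝ) : ℕ → ℝ → ℝ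
  | 0, _ => 1
  | n + 1, a => stepConst b n a * matBeta b n (a + b)

theorem stepConst_pos {b : ℝ} (hb : 0 < b) (n : ℕ) {a : ℝ} (ha : 0 ≤ a) : 0 < stepConst b n a := by
  have h1 : 0 < Real.Gamma (a + 1) := Real.Gamma_pos_of_pos (by linarith)
  have h2 : 0 < Real.Gamma (2 * a + 2 + b * n) := Real.Gamma_pos_of_pos (by positivity)
  unfold stepConst
  positivity

theorem matBeta_pos {b : ℝ} (hb : 0 < b) (n : ℕ) {a : ℝ} (ha : 0 ≤ a) : 0 < matBeta b n a := by
  induction n generalizing a with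
  | zero => exact one_pos
  | succ n ih => exact mul_pos (stepConst_pos hb n ha) (ih (by linarith))

theorem log_matBeta {b : ℝ} (hb : 0 < b) (n : ℕ) {a : ℝ} (ha : 0 ≤ a) :
    Real.log (matBeta b n a) =
      ∑ k ∈ Finset.range n, Real.log (stepConst b (n - 1 - k) (a + b * k)) := by
  induction n generalizing a with
  | zero => simp [matBeta]
  | succ n ih =>
    rw [matBeta, Real.log_mul (stepConst_pos hb n ha).ne' (matBeta_pos hb n (by linarith)).ne',
      ih (by linarith), Finset.sum_range_succ']
    simp only [Nat.cast_zero, mul_zero, add_zero, add_tsub_cancel_right, tsub_zero]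
    rw [add_comm]
    congr 1
    refine Finset.sum_congr rfl fun k _ => ?_
    rw [show n - 1 - k = n - (k + 1) by omega]
    congr 2
    push_cast
    ring

theorem log_matBeta_zero {b : ℝ} (hb : 0 < b) {e : ℕ} (hbe : b * (1 + e) = 1) (n : ℕ) :
    Real.log (matBeta b n 0) = (n + 3 / 2 * b * (n * (n - 1))) * Real.log 2 +
      b * (n * (n - 1) / 2) * Real.log Real.pi +
      (2 * logGammaSum b n - logGammaSum b (2 * n + e) + logGammaSum b (n + e)) := by
  have hs : ∑ k ∈ Finset.range n, (k : ℝ) = n * (n - 1) / 2 := by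
    clear hbe
    induction n with
    | zero => simp
    | succ n ih => rw [Finset.sum_range_succ, ih]; push_cast; ring
  have hshift : logGammaSum b (2 * n + e) = logGammaSum b (n + e) +
      ∑ k ∈ Finset.range n, Real.log (Real.Gamma (2 + b * (n - 1 + k))) := by
    rw [show 2 * n + e = (n + e) + n by ring, logGammaSum, logGammaSum, Finset.sum_range_add]
    congr 1
    refine Finset.sum_congr rfl fun k _ => ?_
    congr 2
    push_cast
    linear_combination hbe
  have hterm : ∀ k ∈ Finset.range n, Real.log (stepConst b (n - 1 - k) (0 + b * k)) =
      (1 + b * (n - 1)) * Real.log 2 + b * Real.log 2 * k + b * (n - 1) * Real.log Real.pi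
        - b * Real.log Real.pi * k +
        2 * Real.log (Real.Gamma (1 + b * k))
        - Real.log (Real.Gamma (2 + b * (n - 1 + k))) := by
    intro k hk
    have hkn : k + 1 ≤ n := Finset.mem_range.1 hk
    have hcast : ((n - 1 - k : ℕ) : ℝ) = n - 1 - k := by
      rw [show n - 1 - k = n - (k + 1) by omega, Nat.cast_sub hkn]
      push_cast
      ring
    have hk0 : (0 : ℝ) ≤ b * k := by positivity
    have hnk : (0 : ℝ) ≤ b * (n - 1 + k) := by
      have : (1 : ℝ) ≤ n := by exact_mod_cast (by omega : 1 ≤ n)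
      have : (0 : ℝ) ≤ n - 1 + k := by linarith [(Nat.cast_nonneg k : (0 : ℝ) ≤ k)]
      positivity
    have h1 : 0 < Real.Gamma (b * k + 1) := Real.Gamma_pos_of_pos (by linarith)
    have h2 : 0 < Real.Gamma (2 + b * (n - 1 + k)) := Real.Gamma_pos_of_pos (by linarith)
    rw [stepConst, hcast, zero_add,
      show 2 * (b * (k : ℝ)) + 2 + b * (n - 1 - k) = 2 + b * (n - 1 + k) by ring,
      Real.log_div (by positivity) h2.ne', Real.log_mul (by positivity) (by positivity),
      Real.log_mul (by positivity) (by positivity), Real.log_rpow two_pos,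
      Real.log_rpow Real.pi_pos, Real.log_pow, add_comm (b * (k : ℝ)) 1]
    push_cast
    ring
  rw [log_matBeta hb n le_rfl, Finset.sum_congr rfl hterm, hshift]
  simp only [Finset.sum_add_distrib, Finset.sum_sub_distrib, ← Finset.mul_sum, hs,
    Finset.sum_const, Finset.card_range, nsmul_eq_mul]
  rw [logGammaSum]
  ring

theorem tendsto_matBeta {b : ℝ} (hb : 0 < b) {e : ℕ} (he : e ≤ 1) (hbe : b * (1 + e) = 1) :
    Tendsto (fun n : ℕ => (n : ℝ) ^ ((1 : ℝ) / 2) * matBeta b n 0 ^ (1 / (b * (n : ℝ) ^ 2)))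
      atTop (nhds ((Real.pi / (2 * b)) ^ ((1 : ℝ) / 2) * Real.exp (3 / 4))) := by
  have hone : Tendsto (fun n : ℕ => 1 / (n : ℝ)) atTop (nhds 0) :=
    tendsto_one_div_atTop_nhds_zero_nat
  have h := (((hone.const_mul ((1 / b - 3 / 2) * Real.log 2 - Real.log Real.pi / 2)).add_const
    (3 / 2 * Real.log 2 + Real.log Real.pi / 2)).add (tendsto_logGammaSum_combination hb he)).rexp
  have hlim : Real.exp ((((1 / b - 3 / 2) * Real.log 2 - Real.log Real.pi / 2) * 0 +
      (3 / 2 * Real.log 2 + Real.log Real.pi / 2)) +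
      (3 / 4 - Real.log b / 2 - 2 * Real.log 2)) =
      (Real.pi / (2 * b)) ^ ((1 : ℝ) / 2) * Real.exp (3 / 4) := by
    rw [Real.rpow_def_of_pos (by positivity), ← Real.exp_add,
      Real.log_div Real.pi_ne_zero (by positivity), Real.log_mul two_ne_zero hb.ne']
    ring_nf
  rw [hlim] at h
  refine h.congr' ?_
  filter_upwards [eventually_gt_atTop 0] with n hn
  have hn' : (0 : ℝ) < n := by exact_mod_cast hn
  rw [Real.rpow_def_of_pos hn', Real.rpow_def_of_pos (matBeta_pos hb n le_rfl), ← Real.exp_add,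
    log_matBeta_zero hb hbe]
  congr 1
  field_simp
  ring

theorem lintegral_comp_linearMap {E : Type*} [NormedAddCommGroup E] [NormedSpace ℝ E]
    [MeasurableSpace E] [BorelSpace E] [FiniteDimensional ℝ E] (μ : Measure E) [μ.IsAddHaarMeasure]
    {f : E →ₗ[ℝ] E} (hf : LinearMap.det f ≠ 0) {g : E → ℝ≥0∞} (hg : Measurable g) :
    ∫⁻ x, g (f x) ∂μ = ENNReal.ofReal |(LinearMap.det f)⁻¹| * ∫⁻ x, g x ∂μ := by
  rw [← lintegral_map hg (LinearMap.continuous_of_finiteDimensional f).measurable,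
    Measure.map_linearMap_addHaar_eq_smul_addHaar μ hf, lintegral_smul_measure, smul_eq_mul]

theorem lintegral_comp_smul {E : Type*} [NormedAddCommGroup E] [NormedSpace ℝ E]
    [MeasurableSpace E] [BorelSpace E] [FiniteDimensional ℝ E] (μ : Measure E) [μ.IsAddHaarMeasure]
    {r : ℝ} (hr : 0 < r) {g : E → ℝ≥0∞} (hg : Measurable g) :
    ENNReal.ofReal (r ^ Module.finrank ℝ E) * ∫⁻ x, g (r • x) ∂μ = ∫⁻ x, g x ∂μ := by
  have hd : 0 < r ^ Module.finrank ℝ E := by positivity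
  rw [← lintegral_map hg (measurable_const_smul r), Measure.map_addHaar_smul μ hr.ne',
    lintegral_smul_measure, smul_eq_mul, ← mul_assoc, ← ENNReal.ofReal_mul hd.le,
    abs_of_pos (by positivity), mul_inv_cancel₀ hd.ne', ENNReal.ofReal_one, one_mul]

theorem lintegral_rpow_mul_exp_neg {c : ℝ} (hc : 0 < c) :
    ∫⁻ t in Set.Ioi (0 : ℝ), ENNReal.ofReal (t ^ c * Real.exp (-t)) =
      ENNReal.ofReal (Real.Gamma (c + 1)) := by
  rw [Real.Gamma_eq_integral (by linarith), ofReal_integral_eq_lintegral_ofReal]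
  · simp only [add_sub_cancel_right, mul_comm]
  · exact Real.GammaIntegral_convergent (by linarith)
  · refine (ae_restrict_iff' measurableSet_Ioi).2 (.of_forall fun t ht => ?_)
    have : (0 : ℝ) < t := ht
    dsimp
    positivity

/-- The integral of a power of `1 - ‖u‖²` over the unit ball of a Euclidean space. -/
theorem lintegral_one_sub_sq_rpow (E : Type*) [NormedAddCommGroup E] [InnerProductSpace ℝ E]
    [MeasurableSpace E] [BorelSpace E] [FiniteDimensional ℝ E] {c : ℝ} (hc : 0 < c) :
    ∫⁻ u : E, ENNReal.ofReal ((max 0 (1 - ‖u‖ ^ 2)) ^ c) =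
      ENNReal.ofReal (Real.pi ^ ((Module.finrank ℝ E : ℝ) / 2) * Real.Gamma (c + 1) /
        Real.Gamma (c + 1 + (Module.finrank ℝ E : ℝ) / 2)) := by
  set d := Module.finrank ℝ E with hd
  set I := ∫⁻ u : E, ENNReal.ofReal ((max 0 (1 - ‖u‖ ^ 2)) ^ c) with hI
  have hG1 : 0 < Real.Gamma (c + 1) := Real.Gamma_pos_of_pos (by linarith)
  have hG2 : 0 < Real.Gamma (c + 1 + (d : ℝ) / 2) := Real.Gamma_pos_of_pos (by positivity)
  let F : E → ℝ → ℝ≥0∞ := fun u t =>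
    ENNReal.ofReal ((max 0 (t - ‖u‖ ^ 2)) ^ c * Real.exp (-t))
  have hF : Measurable (Function.uncurry F) := by
    unfold F Function.uncurry
    fun_prop
  have hleft : ∫⁻ u : E, ∫⁻ t, F u t =
      ENNReal.ofReal (Real.Gamma (c + 1) * Real.pi ^ ((d : ℝ) / 2)) := by
    have h1 : ∀ u : E, ∫⁻ t, F u t =
        ENNReal.ofReal (Real.Gamma (c + 1)) * ENNReal.ofReal (Real.exp (-1 * ‖u‖ ^ 2)) := by
      intro u
      rw [← lintegral_add_right_eq_self _ (‖u‖ ^ 2), ← lintegral_rpow_mul_exp_neg hc,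
        ← lintegral_indicator measurableSet_Ioi, ← lintegral_mul_const _ (by
          refine Measurable.indicator (by fun_prop) measurableSet_Ioi)]
      refine lintegral_congr fun t => ?_
      by_cases ht : 0 < t
      · have : t ∈ Set.Ioi (0 : ℝ) := ht
        rw [Set.indicator_of_mem this, ← ENNReal.ofReal_mul (by positivity)]
        unfold F
        rw [add_sub_cancel_right, max_eq_right ht.le, mul_assoc, ← Real.exp_add]
        ring_nf
      · have : t ∉ Set.Ioi (0 : ℝ) := ht
        unfold F
        rw [Set.indicator_of_notMem this, add_sub_cancel_right, max_eq_left (not_lt.1 ht),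
          Real.zero_rpow hc.ne']
        simp
    have hpi : 0 < Real.pi ^ ((d : ℝ) / 2) := by positivity
    have h2 := GaussianFourier.integral_rexp_neg_mul_sq_norm (V := E) one_pos
    rw [div_one] at h2
    rw [lintegral_congr h1, lintegral_const_mul _ (by fun_prop), ENNReal.ofReal_mul hG1.le,
      ← ofReal_integral_eq_lintegral_ofReal, h2]
    · by_contra h
      rw [integral_undef h] at h2
      exact hpi.ne h2
    · exact .of_forall fun u => (Real.exp_pos _).le
  have hright : ∫⁻ t, ∫⁻ u : E, F u t = ENNReal.ofReal (Real.Gamma (c + 1 + (d : ℝ) / 2)) * I := by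
    have h1 : ∀ t : ℝ, ∫⁻ u : E, F u t = (Set.Ioi (0 : ℝ)).indicator
        (fun t => ENNReal.ofReal (t ^ (c + (d : ℝ) / 2) * Real.exp (-t))) t * I := by
      intro t
      by_cases ht : 0 < t
      · have hm : t ∈ Set.Ioi (0 : ℝ) := ht
        have hs : 0 < √t := Real.sqrt_pos.2 ht
        rw [Set.indicator_of_mem hm, ← lintegral_comp_smul volume hs
          (show Measurable fun u => F u t by unfold F; fun_prop), hI,
          ← lintegral_const_mul _ (by fun_prop),
          ← lintegral_const_mul _ (by fun_prop)]
        refine lintegral_congr fun u => ?_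
        unfold F
        rw [← ENNReal.ofReal_mul (by positivity), ← ENNReal.ofReal_mul (by positivity)]
        congr 1
        have e1 : max 0 (t - ‖√t • u‖ ^ 2) = t * max 0 (1 - ‖u‖ ^ 2) := by
          rw [norm_smul, mul_pow, Real.norm_eq_abs, sq_abs, Real.sq_sqrt ht.le,
            mul_max_of_nonneg _ _ ht.le]
          ring_nf
        have e2 : √t ^ Module.finrank ℝ E = t ^ ((d : ℝ) / 2) := by
          rw [Real.sqrt_eq_rpow, ← Real.rpow_natCast, ← Real.rpow_mul ht.le, ← hd]
          ring_nf
        rw [e1, e2, Real.mul_rpow ht.le (le_max_left _ _), Real.rpow_add ht]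
        ring
      · have hm : t ∉ Set.Ioi (0 : ℝ) := ht
        rw [Set.indicator_of_notMem hm, zero_mul]
        refine (lintegral_eq_zero_iff (by unfold F; fun_prop)).2 (.of_forall fun u => ?_)
        have : t - ‖u‖ ^ 2 ≤ 0 := by nlinarith [sq_nonneg ‖u‖]
        simp [F, max_eq_left this, Real.zero_rpow hc.ne']
    rw [lintegral_congr h1, lintegral_mul_const _
      (Measurable.indicator (by fun_prop) measurableSet_Ioi),
      lintegral_indicator measurableSet_Ioi, lintegral_rpow_mul_exp_neg (by positivity)]
    ring_nf
  rw [lintegral_lintegral_swap hF.aemeasurable, hright] at hleft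
  rw [ENNReal.ofReal_div_of_pos hG2, ENNReal.eq_div_iff (by simpa using hG2) (by simp), hleft,
    mul_comm]

theorem lintegral_mul_sub_rpow {a : ℝ} (ha : 0 ≤ a) (L : ℝ) :
    ∫⁻ x : ℝ, (if 0 < x ∧ 0 < L - x then ENNReal.ofReal ((x * (L - x)) ^ a) else 0) =
      ENNReal.ofReal ((max 0 L) ^ (2 * a + 1) * ProbabilityTheory.beta (a + 1) (a + 1)) := by
  have hm : ∀ L : ℝ, MeasurableSet {x : ℝ | 0 < x ∧ 0 < L - x} := fun L =>
    (measurableSet_lt measurable_const measurable_id).inter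
      (measurableSet_lt measurable_const (measurable_const.sub measurable_id))
  have hB : 0 < ProbabilityTheory.beta (a + 1) (a + 1) :=
    ProbabilityTheory.beta_pos (by linarith) (by linarith)
  rcases le_or_gt L 0 with hL | hL
  · rw [max_eq_left hL, Real.zero_rpow (by linarith), zero_mul, ENNReal.ofReal_zero]
    refine (lintegral_eq_zero_iff (.ite (hm L) (by fun_prop) (by fun_prop))).2
      (.of_forall fun x => ?_)
    exact if_neg fun h => by linarith [h.1, h.2]
  · rw [max_eq_right hL.le, ← lintegral_comp_smul volume hL
      (.ite (hm L) (by fun_prop) (by fun_prop)), ← mul_one (ENNReal.ofReal (L ^ _ * _)),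
      ← ProbabilityTheory.lintegral_betaPDF_eq_one (α := a + 1) (β := a + 1)
        (by linarith) (by linarith), Module.finrank_self, pow_one,
      ← lintegral_const_mul _ (show Measurable (ProbabilityTheory.betaPDF (a + 1) (a + 1)) from
          (ProbabilityTheory.measurable_betaPDFReal _ _).ennreal_ofReal),
      ← lintegral_const_mul _ (.ite (by
        convert! measurable_const_smul L (hm L)) (by fun_prop) (by fun_prop))]
    refine lintegral_congr fun x => ?_
    have hiff : (0 < L • x ∧ 0 < L - L • x) ↔ (0 < x ∧ x < 1) := by
      rw [smul_eq_mul, mul_pos_iff_of_pos_left hL, show L - L * x = L * (1 - x) by ring,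
        mul_pos_iff_of_pos_left hL, sub_pos]
    rw [ProbabilityTheory.betaPDF_eq]
    by_cases hx : 0 < x ∧ x < 1
    · rw [if_pos (hiff.2 hx), if_pos hx, ← ENNReal.ofReal_mul hL.le,
        ← ENNReal.ofReal_mul (by positivity)]
      congr 1
      have h1 : 0 < 1 - x := by linarith [hx.2]
      rw [smul_eq_mul, show L * x * (L - L * x) = (L * L) * (x * (1 - x)) by ring,
        Real.mul_rpow (by positivity) (mul_pos hx.1 h1).le, Real.mul_rpow hL.le hL.le,
        Real.mul_rpow hx.1.le h1.le, show 2 * a + 1 = a + a + 1 by ring,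
        Real.rpow_add hL, Real.rpow_add hL, Real.rpow_one]
      simp only [add_sub_cancel_right]
      field_simp
    · rw [if_neg (mt hiff.1 hx), if_neg hx]
      simp

section BlockMatrices

open scoped ComplexOrder

variable {𝕜 : Type} [RCLike 𝕜] {n : ℕ}

/-- The `(n + 1) × (n + 1)` matrix with blocks `Y`, `v`, `vᴴ`, `x`. -/
def blockMat (Y : Matrix (Fin n) (Fin n) 𝕜) (v : Fin n → 𝕜) (x : ℝ) :
    Matrix (Fin (n + 1)) (Fin (n + 1)) 𝕜 :=
  (fromBlocks Y (replicateCol (Fin 1) v) (replicateCol (Fin 1) v)ᴴ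
    (diagonal fun _ => (x : 𝕜))).submatrix finSumFinEquiv.symm finSumFinEquiv.symm

theorem one_add_blockMat (Y : Matrix (Fin n) (Fin n) 𝕜) (v : Fin n → 𝕜) (x : ℝ) :
    1 + blockMat Y v x = blockMat (1 + Y) v (1 + x) := by
  have h : (1 : Matrix (Fin (n + 1)) (Fin (n + 1)) 𝕜) =
      (1 : Matrix (Fin n ⊕ Fin 1) (Fin n ⊕ Fin 1) 𝕜).submatrix
        finSumFinEquiv.symm finSumFinEquiv.symm := by simp
  rw [h, blockMat, blockMat, ← fromBlocks_one,
    show ∀ (P Q : Matrix (Fin n ⊕ Fin 1) (Fin n ⊕ Fin 1) 𝕜) (e : Fin (n + 1) → Fin n ⊕ Fin 1),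
      P.submatrix e e + Q.submatrix e e = (P + Q).submatrix e e from fun _ _ _ => rfl,
    fromBlocks_add, ← diagonal_one, ← diagonal_one, diagonal_add]
  simp

theorem one_sub_blockMat (Y : Matrix (Fin n) (Fin n) 𝕜) (v : Fin n → 𝕜) (x : ℝ) :
    1 - blockMat Y v x = blockMat (1 - Y) (-v) (1 - x) := by
  have h : -blockMat Y v x = blockMat (-Y) (-v) (-x) := by
    rw [blockMat, blockMat,
      show ∀ (P : Matrix (Fin n ⊕ Fin 1) (Fin n ⊕ Fin 1) 𝕜) (e : Fin (n + 1) → Fin n ⊕ Fin 1),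
        -P.submatrix e e = (-P).submatrix e e from fun _ _ => rfl,
      fromBlocks_neg, diagonal_neg]
    congr 2
    · ext; simp
    · ext; simp
  rw [sub_eq_add_neg, h, one_add_blockMat, sub_eq_add_neg, sub_eq_add_neg]

/-- The quadratic form `v ↦ v* A⁻¹ v`. -/
def invForm (A : Matrix (Fin n) (Fin n) 𝕜) (v : Fin n → 𝕜) : ℝ :=
  RCLike.re (star v ⬝ᵥ (A⁻¹ *ᵥ v))

theorem invForm_neg (A : Matrix (Fin n) (Fin n) 𝕜) (v : Fin n → 𝕜) :
    invForm A (-v) = invForm A v := by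
  simp [invForm, mulVec_neg]

theorem ofReal_invForm {A : Matrix (Fin n) (Fin n) 𝕜} (hA : A.PosDef) (v : Fin n → 𝕜) :
    ((invForm A v : ℝ) : 𝕜) = star v ⬝ᵥ (A⁻¹ *ᵥ v) :=
  RCLike.conj_eq_iff_re.1
    (RCLike.conj_eq_iff_im.2
      (RCLike.nonneg_iff.1 (hA.inv.posSemidef.dotProduct_mulVec_nonneg v)).2)

theorem schur_complement_replicateCol {A : Matrix (Fin n) (Fin n) 𝕜} (hA : A.PosDef)
    (v : Fin n → 𝕜) (x : ℝ) :
    (diagonal fun _ => (x : 𝕜)) - (replicateCol (Fin 1) v)ᴴ * A⁻¹ * replicateCol (Fin 1) v =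
      diagonal fun _ : Fin 1 => ((x - invForm A v : ℝ) : 𝕜) := by
  ext i j
  rw [Subsingleton.elim j i, RCLike.ofReal_sub, ofReal_invForm hA, Matrix.mul_assoc]
  simp [Matrix.mul_apply, dotProduct, mulVec]

theorem det_blockMat {A : Matrix (Fin n) (Fin n) 𝕜} (hA : A.PosDef) (v : Fin n → 𝕜) (x : ℝ) :
    (blockMat A v x).det = A.det * ((x - invForm A v : ℝ) : 𝕜) := by
  let _ := hA.isUnit.invertible
  rw [blockMat, det_submatrix_equiv_self, det_fromBlocks₁₁, invOf_eq_nonsing_inv,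
    schur_complement_replicateCol hA]
  simp

theorem PosDef_of_blockMat {A : Matrix (Fin n) (Fin n) 𝕜} {v : Fin n → 𝕜} {x : ℝ}
    (h : (blockMat A v x).PosDef) : A.PosDef := by
  have := h.submatrix (e := fun i : Fin n => finSumFinEquiv (Sum.inl i : Fin n ⊕ Fin 1))
    (finSumFinEquiv.injective.comp Sum.inl_injective)
  convert this using 1
  ext i j
  simp [blockMat]

theorem posDef_blockMat_iff {A : Matrix (Fin n) (Fin n) 𝕜} (hA : A.PosDef) (v : Fin n → 𝕜)
    (x : ℝ) : (blockMat A v x).PosDef ↔ 0 < x - invForm A v := by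
  let _ := hA.isUnit.invertible
  constructor
  · intro h
    have h1 := h.det_pos
    rw [det_blockMat hA] at h1
    exact RCLike.ofReal_pos.1 (pos_of_mul_pos_right h1 hA.det_pos.le)
  · intro h
    have hs : (blockMat A v x).PosSemidef := by
      rw [blockMat, posSemidef_submatrix_equiv, PosDef.fromBlocks₁₁ _ _ hA,
        schur_complement_replicateCol hA]
      exact PosSemidef.diagonal fun _ => RCLike.ofReal_nonneg.2 h.le
    rw [hs.posDef_iff_det_ne_zero, det_blockMat hA]
    exact mul_ne_zero hA.det_pos.ne' (RCLike.ofReal_ne_zero.2 h.ne')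

open scoped Classical in
/-- The density `det(1 + A)^a det(1 - A)^a` on the open operator norm ball, extended by zero. -/
def detWeight (a : ℝ) (A : Matrix (Fin n) (Fin n) 𝕜) : ℝ≥0∞ :=
  if (1 + A).PosDef ∧ (1 - A).PosDef then
    ENNReal.ofReal ((RCLike.re (1 + A).det * RCLike.re (1 - A).det) ^ a) else 0

theorem PosDef_re_det_pos {A : Matrix (Fin n) (Fin n) 𝕜} (hA : A.PosDef) :
    0 < RCLike.re A.det := (RCLike.pos_iff.1 hA.det_pos).1

theorem lintegral_detWeight_blockMat {Y : Matrix (Fin n) (Fin n) 𝕜} (h1 : (1 + Y).PosDef)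
    (h2 : (1 - Y).PosDef) (v : Fin n → 𝕜) {a : ℝ} (ha : 0 ≤ a) :
    ∫⁻ x : ℝ, detWeight a (blockMat Y v x) =
      ENNReal.ofReal ((RCLike.re (1 + Y).det * RCLike.re (1 - Y).det) ^ a *
        ProbabilityTheory.beta (a + 1) (a + 1)) *
      ENNReal.ofReal ((max 0 (2 - (invForm (1 + Y) v + invForm (1 - Y) v))) ^ (2 * a + 1)) := by
  have hD := mul_pos (PosDef_re_det_pos h1) (PosDef_re_det_pos h2)
  set D := RCLike.re (1 + Y).det * RCLike.re (1 - Y).det with hDdef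
  set p := invForm (1 + Y) v with hp
  set q := invForm (1 - Y) v with hq
  have hB : 0 < ProbabilityTheory.beta (a + 1) (a + 1) :=
    ProbabilityTheory.beta_pos (by linarith) (by linarith)
  rw [mul_comm (D ^ a), ENNReal.ofReal_mul hB.le, mul_comm (ENNReal.ofReal _), mul_assoc,
    ← ENNReal.ofReal_mul hB.le, mul_comm (ProbabilityTheory.beta _ _),
    ← lintegral_mul_sub_rpow ha, ← lintegral_add_right_eq_self _ (p - 1),
    ← lintegral_const_mul' _ _ ENNReal.ofReal_ne_top]
  refine lintegral_congr fun x => ?_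
  have e1 : 1 + (x + (p - 1)) - invForm (1 + Y) v = x := by rw [← hp]; ring
  have e2 : 1 - (x + (p - 1)) - invForm (1 - Y) (-v) = 2 - (p + q) - x := by
    rw [invForm_neg, ← hq]; ring
  rw [detWeight, one_add_blockMat, one_sub_blockMat]
  simp only [posDef_blockMat_iff h1, posDef_blockMat_iff h2, det_blockMat h1, det_blockMat h2,
    RCLike.re_mul_ofReal, e1, e2]
  split_ifs with hx
  · rw [← ENNReal.ofReal_mul (by positivity), ← Real.mul_rpow hD.le (mul_pos hx.1 hx.2).le, hDdef]
    congr 2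
    ring
  · simp

theorem abs_norm_eq_pow (z : 𝕜) : |Algebra.norm ℝ z| = ‖z‖ ^ Module.finrank ℝ 𝕜 := by
  have h1 : Algebra.norm ℝ (RCLike.conjAe z) = Algebra.norm ℝ z :=
    Algebra.norm_eq_of_algEquiv _ _
  have h2 : Algebra.norm ℝ (z * RCLike.conjAe z) = (‖z‖ ^ 2) ^ Module.finrank ℝ 𝕜 := by
    have : z * RCLike.conjAe z = algebraMap ℝ 𝕜 (‖z‖ ^ 2) := by
      rw [RCLike.conjAe_coe, RCLike.mul_conj]
      simp
    rw [this, Algebra.norm_algebraMap]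
  rw [map_mul, h1, ← pow_mul, mul_comm 2, pow_mul, ← sq] at h2
  rw [← abs_of_nonneg (by positivity : 0 ≤ ‖z‖ ^ Module.finrank ℝ 𝕜)]
  exact (sq_eq_sq_iff_abs_eq_abs _ _).1 h2

theorem abs_det_restrictScalars {E : Type*} [AddCommGroup E] [Module ℝ E] [Module 𝕜 E]
    [IsScalarTower ℝ 𝕜 E] (f : E →ₗ[𝕜] E) :
    |LinearMap.det (f.restrictScalars ℝ)| = ‖LinearMap.det f‖ ^ Module.finrank ℝ 𝕜 := by
  rw [LinearMap.det_restrictScalars, abs_norm_eq_pow]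

theorem det_inv_add_inv {A B : Matrix (Fin n) (Fin n) 𝕜} (hA : A.PosDef) (hB : B.PosDef) :
    (A⁻¹ + B⁻¹).det * (A.det * B.det) = (A + B).det := by
  have hA' := (isUnit_iff_isUnit_det _).1 hA.isUnit
  have hB' := (isUnit_iff_isUnit_det _).1 hB.isUnit
  rw [mul_comm A.det, ← mul_assoc, mul_comm _ B.det, ← det_mul, ← det_mul, Matrix.mul_add,
    Matrix.mul_nonsing_inv _ hB', Matrix.add_mul, Matrix.mul_assoc, Matrix.nonsing_inv_mul _ hA',
    Matrix.mul_one, Matrix.one_mul,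
    add_comm]

end BlockMatrices

section QuadraticIntegral

open scoped ComplexOrder MatrixOrder

variable {𝕜 : Type} [RCLike 𝕜] {n : ℕ}

theorem exists_conjTranspose_mul_self {A : Matrix (Fin n) (Fin n) 𝕜} (hA : A.PosSemidef) :
    ∃ B : Matrix (Fin n) (Fin n) 𝕜, A = Bᴴ * B :=
  CStarAlgebra.nonneg_iff_eq_star_mul_self.mp hA.nonneg

theorem re_dotProduct_conjTranspose_mul_self (B : Matrix (Fin n) (Fin n) 𝕜)
    (w : EuclideanSpace 𝕜 (Fin n)) :
    RCLike.re (star w.ofLp ⬝ᵥ ((Bᴴ * B) *ᵥ w.ofLp)) = ‖toEuclideanLin B w‖ ^ 2 := by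
  rw [← inner_self_eq_norm_sq (𝕜 := 𝕜), EuclideanSpace.inner_eq_star_dotProduct,
    ofLp_toLpLin, toLin'_apply, dotProduct_comm (B *ᵥ w.ofLp), star_mulVec, ← mulVec_mulVec,
    dotProduct_mulVec]

theorem lintegral_rpow_invForm [MeasurableSpace 𝕜] [BorelSpace 𝕜]
    {Y : Matrix (Fin n) (Fin n) 𝕜} (h1 : (1 + Y).PosDef)
    (h2 : (1 - Y).PosDef) {b c : ℝ} (hc : 0 < c) (hb : (Module.finrank ℝ 𝕜 : ℝ) = 2 * b) :
    ∫⁻ w : EuclideanSpace 𝕜 (Fin n), ENNReal.ofReal ((max 0 (2 -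
        (invForm (1 + Y) ((√2)⁻¹ • w).ofLp + invForm (1 - Y) ((√2)⁻¹ • w).ofLp))) ^ c) =
      ENNReal.ofReal ((2 ^ n * (RCLike.re (1 + Y).det * RCLike.re (1 - Y).det)) ^ b * (2 ^ c *
        (Real.pi ^ (b * n) * Real.Gamma (c + 1) / Real.Gamma (c + 1 + b * n)))) := by
  obtain ⟨B, hB⟩ := exists_conjTranspose_mul_self (h1.inv.add h2.inv).posSemidef
  have hBdet : ‖B.det‖ ^ 2 * (RCLike.re (1 + Y).det * RCLike.re (1 - Y).det) = 2 ^ n := by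
    have h := det_inv_add_inv h1 h2
    have e : (1 + Y + (1 - Y)) = (2 : 𝕜) • (1 : Matrix (Fin n) (Fin n) 𝕜) := by
      rw [two_smul]; abel
    have r1 : (1 + Y).det = ((RCLike.re (1 + Y).det : ℝ) : 𝕜) :=
      (RCLike.conj_eq_iff_re.1 (RCLike.conj_eq_iff_im.2 (RCLike.pos_iff.1 h1.det_pos).2)).symm
    have r2 : (1 - Y).det = ((RCLike.re (1 - Y).det : ℝ) : 𝕜) :=
      (RCLike.conj_eq_iff_re.1 (RCLike.conj_eq_iff_im.2 (RCLike.pos_iff.1 h2.det_pos).2)).symm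
    rw [e, det_smul, det_one, mul_one, Fintype.card_fin, r1, r2, hB, det_mul, det_conjTranspose,
      RCLike.star_def, RCLike.conj_mul] at h
    exact_mod_cast h
  have hD := mul_pos (PosDef_re_det_pos h1) (PosDef_re_det_pos h2)
  set D := RCLike.re (1 + Y).det * RCLike.re (1 - Y).det with hDdef
  let f : EuclideanSpace 𝕜 (Fin n) →ₗ[ℝ] EuclideanSpace 𝕜 (Fin n) :=
    (toEuclideanLin ((2⁻¹ : 𝕜) • B)).restrictScalars ℝ
  have hfdet : |(LinearMap.det f)⁻¹| = (2 ^ n * D) ^ b := by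
    have e : ‖((2⁻¹ : 𝕜) • B).det‖ ^ 2 = (2 ^ n * D)⁻¹ := by
      rw [det_smul, norm_mul, mul_pow, eq_div_of_mul_eq hD.ne' hBdet, Fintype.card_fin, norm_pow,
        norm_inv, RCLike.norm_two]
      have : ((2 : ℝ)⁻¹ ^ n) ^ 2 * (2 ^ n) ^ 2 = 1 := by
        rw [← mul_pow, ← mul_pow, inv_mul_cancel₀ two_ne_zero, one_pow, one_pow]
      field_simp at this ⊢
      linarith
    rw [abs_inv, abs_det_restrictScalars, LinearMap.det_toLpLin, ← Real.rpow_natCast, hb,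
      Real.rpow_mul (norm_nonneg _), Real.rpow_two, e, Real.inv_rpow (by positivity), inv_inv]
  have hf0 : LinearMap.det f ≠ 0 := by
    intro h
    rw [h] at hfdet
    simp at hfdet
    exact absurd hfdet (by positivity)
  have hquad (w : EuclideanSpace 𝕜 (Fin n)) :
      invForm (1 + Y) ((√2)⁻¹ • w).ofLp + invForm (1 - Y) ((√2)⁻¹ • w).ofLp =
        2 * ‖f w‖ ^ 2 := by
    have e1 : ((√2)⁻¹ • w).ofLp = (((√2)⁻¹ : ℝ) : 𝕜) • w.ofLp := by
      ext i
      simp [RCLike.real_smul_eq_coe_mul]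
    have e2 : ‖f w‖ ^ 2 = 2⁻¹ ^ 2 * ‖toEuclideanLin B w‖ ^ 2 := by
      rw [← mul_pow]
      congr 1
      change ‖toEuclideanLin ((2⁻¹ : 𝕜) • B) w‖ = _
      rw [map_smul, LinearMap.smul_apply, norm_smul, norm_inv, RCLike.norm_two]
    have e3 (A : Matrix (Fin n) (Fin n) 𝕜) :
        invForm A ((√2)⁻¹ • w).ofLp = 2⁻¹ * RCLike.re (star w.ofLp ⬝ᵥ (A⁻¹ *ᵥ w.ofLp)) := by
      rw [invForm, e1, mulVec_smul, dotProduct_smul, star_smul, smul_dotProduct, smul_smul,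
        RCLike.star_def, RCLike.conj_ofReal, ← RCLike.ofReal_mul, smul_eq_mul,
        RCLike.re_ofReal_mul, ← mul_inv, Real.mul_self_sqrt (by norm_num)]
    rw [e2, ← re_dotProduct_conjTranspose_mul_self, ← hB, add_mulVec, dotProduct_add, map_add,
      e3, e3]
    ring
  have hfin : (Module.finrank ℝ (EuclideanSpace 𝕜 (Fin n)) : ℝ) / 2 = b * n := by
    rw [← Module.finrank_mul_finrank ℝ 𝕜 (EuclideanSpace 𝕜 (Fin n)), finrank_euclideanSpace_fin]
    push_cast
    rw [hb]
    ring
  calc _ = ∫⁻ w, (fun u : EuclideanSpace 𝕜 (Fin n) =>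
        ENNReal.ofReal (2 ^ c) * ENNReal.ofReal ((max 0 (1 - ‖u‖ ^ 2)) ^ c)) (f w) := by
        refine lintegral_congr fun w => ?_
        beta_reduce
        rw [hquad, ← ENNReal.ofReal_mul (by positivity), ← Real.mul_rpow (by norm_num) (by simp),
          mul_max_of_nonneg _ _ (by norm_num), mul_zero, mul_sub, mul_one]
    _ = _ := by
        rw [lintegral_comp_linearMap volume hf0
            (g := fun u => ENNReal.ofReal (2 ^ c) * ENNReal.ofReal ((max 0 (1 - ‖u‖ ^ 2)) ^ c))
            (by fun_prop), hfdet, lintegral_const_mul' _ _ ENNReal.ofReal_ne_top,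
            lintegral_one_sub_sq_rpow _ hc, hfin,
          ← ENNReal.ofReal_mul (by positivity), ← ENNReal.ofReal_mul (by positivity)]

theorem detWeight_blockMat_eq_zero {Y : Matrix (Fin n) (Fin n) 𝕜}
    (h : ¬((1 + Y).PosDef ∧ (1 - Y).PosDef)) (a : ℝ) (v : Fin n → 𝕜) (x : ℝ) :
    detWeight a (blockMat Y v x) = 0 := by
  refine if_neg fun h' => h ⟨?_, ?_⟩
  · exact PosDef_of_blockMat (one_add_blockMat Y v x ▸ h'.1)
  · exact PosDef_of_blockMat (one_sub_blockMat Y v x ▸ h'.2)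

theorem lintegral_lintegral_detWeight_blockMat [MeasurableSpace 𝕜] [BorelSpace 𝕜]
    (Y : Matrix (Fin n) (Fin n) 𝕜) {a b : ℝ} (ha : 0 ≤ a)
    (hb : (Module.finrank ℝ 𝕜 : ℝ) = 2 * b) :
    ∫⁻ w : EuclideanSpace 𝕜 (Fin n), ∫⁻ x : ℝ,
        detWeight a (blockMat Y ((√2)⁻¹ • w).ofLp x) =
      ENNReal.ofReal (stepConst b n a) * detWeight (a + b) Y := by
  by_cases h : (1 + Y).PosDef ∧ (1 - Y).PosDef
  swap
  · simp_rw [detWeight_blockMat_eq_zero h, detWeight, if_neg h, lintegral_zero, mul_zero]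
  obtain ⟨h1, h2⟩ := h
  have hb0 : 0 < b := by
    have : (0 : ℝ) < Module.finrank ℝ 𝕜 := Nat.cast_pos.2 Module.finrank_pos
    linarith
  have hD := mul_pos (PosDef_re_det_pos h1) (PosDef_re_det_pos h2)
  simp_rw [lintegral_detWeight_blockMat h1 h2 _ ha]
  rw [lintegral_const_mul' _ _ ENNReal.ofReal_ne_top,
    lintegral_rpow_invForm h1 h2 (by linarith) hb, detWeight, if_pos ⟨h1, h2⟩]
  set D := RCLike.re (1 + Y).det * RCLike.re (1 - Y).det
  have hG : 0 < Real.Gamma (2 * a + 2) := Real.Gamma_pos_of_pos (by linarith)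
  have hB := ProbabilityTheory.beta_pos (α := a + 1) (β := a + 1) (by linarith) (by linarith)
  rw [← ENNReal.ofReal_mul (by positivity),
    ← ENNReal.ofReal_mul (stepConst_pos hb0 n ha).le]
  congr 1
  have e : ((2 : ℝ) ^ n) ^ b = 2 ^ (b * n) := by
    rw [mul_comm, Real.rpow_mul two_pos.le, Real.rpow_natCast]
  rw [stepConst, ProbabilityTheory.beta, Real.rpow_add hD, Real.mul_rpow (by positivity) hD.le, e,
    Real.rpow_add two_pos _ (b * n), show a + 1 + (a + 1) = 2 * a + 2 by ring,
    show 2 * a + 1 + 1 = 2 * a + 2 by ring]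
  field_simp

end QuadraticIntegral

section Recursion

open scoped ComplexOrder

variable {𝕜 : Type} [RCLike 𝕜] {n : ℕ}

theorem isClosed_setOf_posSemidef :
    IsClosed {A : Matrix (Fin n) (Fin n) 𝕜 | A.PosSemidef} := by
  simp_rw [posSemidef_iff_dotProduct_mulVec, IsHermitian, Set.ofPred_and, Set.ofPred_forall]
  refine (isClosed_eq (by fun_prop) continuous_id).inter (isClosed_iInter fun x => ?_)
  simp only [RCLike.nonneg_iff (K := 𝕜), Set.ofPred_and]
  exact (isClosed_le continuous_const (by fun_prop)).inter (isClosed_eq (by fun_prop)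
    continuous_const)

theorem measurableSet_posDef {E : Type*} [TopologicalSpace E] [MeasurableSpace E] [BorelSpace E]
    {f : E → Matrix (Fin n) (Fin n) 𝕜} (hf : Continuous f) :
    MeasurableSet {y | (f y).PosDef} := by
  have : {y | (f y).PosDef} = {y | (f y).PosSemidef} ∩ {y | (f y).det ≠ 0} := by
    ext y
    exact ⟨fun h => ⟨h.posSemidef, h.det_pos.ne'⟩, fun h => h.1.posDef_iff_det_ne_zero.2 h.2⟩
  rw [this]
  exact (isClosed_setOf_posSemidef.preimage hf).measurableSet.inter
    (isOpen_ne_fun (by fun_prop) continuous_const).measurableSet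

theorem measurable_detWeight {E : Type*} [TopologicalSpace E] [MeasurableSpace E] [BorelSpace E]
    {f : E → Matrix (Fin n) (Fin n) 𝕜} (hf : Continuous f) (a : ℝ) :
    Measurable fun y => detWeight a (f y) := by
  refine Measurable.ite ((measurableSet_posDef (continuous_const.add hf)).inter
    (measurableSet_posDef (continuous_const.sub hf))) ?_ measurable_const
  have h1 : Continuous fun y => RCLike.re (1 + f y).det := by fun_prop
  have h2 : Continuous fun y => RCLike.re (1 - f y).det := by fun_prop
  exact ((h1.measurable.mul h2.measurable).pow_const a).ennreal_ofReal

theorem re_trace_mul_conjTranspose {ι : Type*} [Fintype ι] (A : Matrix ι ι 𝕜) :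
    RCLike.re (A * Aᴴ).trace = ∑ i, ∑ j, ‖A i j‖ ^ 2 := by
  simp only [trace, diag_apply, Matrix.mul_apply, conjTranspose_apply, map_sum, RCLike.star_def,
    RCLike.mul_conj]
  norm_cast

theorem re_trace_blockMat (Y : Matrix (Fin n) (Fin n) 𝕜) (v : Fin n → 𝕜) (x : ℝ) :
    RCLike.re (blockMat Y v x * (blockMat Y v x)ᴴ).trace =
      RCLike.re (Y * Yᴴ).trace + 2 * ∑ i, ‖v i‖ ^ 2 + x ^ 2 := by
  rw [re_trace_mul_conjTranspose, re_trace_mul_conjTranspose, ← finSumFinEquiv.sum_comp,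
    Finset.sum_congr rfl fun i _ => (finSumFinEquiv.sum_comp _).symm]
  simp [blockMat, Finset.sum_add_distrib, two_mul, add_assoc]

theorem isHermitian_blockMat {Y : Matrix (Fin n) (Fin n) 𝕜} (hY : Y.IsHermitian) (v : Fin n → 𝕜)
    (x : ℝ) : (blockMat Y v x).IsHermitian := by
  refine IsHermitian.submatrix (IsHermitian.fromBlocks hY rfl ?_) _
  exact isHermitian_diagonal_iff.2 fun _ => RCLike.conj_ofReal x

theorem blockMat_add (Y Y' : Matrix (Fin n) (Fin n) 𝕜) (v v' : Fin n → 𝕜) (x x' : ℝ) :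
    blockMat (Y + Y') (v + v') (x + x') = blockMat Y v x + blockMat Y' v' x' := by
  ext i j
  obtain ⟨i, rfl⟩ := finSumFinEquiv.surjective i
  obtain ⟨j, rfl⟩ := finSumFinEquiv.surjective j
  rcases i with i | i <;> rcases j with j | j <;> simp [blockMat, Fin.fin_one_eq_zero]

theorem blockMat_smul (r : ℝ) (Y : Matrix (Fin n) (Fin n) 𝕜) (v : Fin n → 𝕜) (x : ℝ) :
    blockMat (r • Y) (r • v) (r • x) = r • blockMat Y v x := by
  ext i j
  obtain ⟨i, rfl⟩ := finSumFinEquiv.surjective i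
  obtain ⟨j, rfl⟩ := finSumFinEquiv.surjective j
  rcases i with i | i <;> rcases j with j | j <;>
    simp [blockMat, Fin.fin_one_eq_zero, RCLike.real_smul_eq_coe_mul]

/-- A linear map into the self-adjoint matrices, viewed as a linear map into all matrices. -/
def valLinearMap {E : Type*} [AddCommGroup E] [Module ℝ E] (T : E →ₗ[ℝ] HMat 𝕜 n) :
    E →ₗ[ℝ] Matrix (Fin n) (Fin n) 𝕜 where
  toFun y := (T y).val
  map_add' x y := by rw [map_add, AddSubgroup.coe_add]
  map_smul' r y := by rw [map_smul, selfAdjoint.val_smul, RingHom.id_apply]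

/-- The isometry assembling a self-adjoint matrix of size `n + 1` from its blocks. -/
def blockIsometry {E E' : Type*} [NormedAddCommGroup E] [InnerProductSpace ℝ E]
    [NormedAddCommGroup E'] [InnerProductSpace ℝ E']
    (T : E ≃ₗ[ℝ] HMat 𝕜 n) (hT : ∀ y, ‖y‖ ^ 2 = RCLike.re ((T y).val * ((T y).val)ᴴ).trace)
    (T' : E' ≃ₗ[ℝ] HMat 𝕜 (n + 1))
    (hT' : ∀ y, ‖y‖ ^ 2 = RCLike.re ((T' y).val * ((T' y).val)ᴴ).trace) :
    WithLp 2 (E × WithLp 2 (EuclideanSpace 𝕜 (Fin n) × ℝ)) →ₗᵢ[ℝ] E' where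
  toFun z := T'.symm ⟨blockMat (T z.fst).val ((√2)⁻¹ • z.snd.fst).ofLp z.snd.snd,
    isHermitian_blockMat (T z.fst).prop _ _⟩
  map_add' z z' := by
    rw [← map_add]
    congr 1
    ext1
    simp only [AddSubgroup.coe_add, WithLp.add_fst, WithLp.add_snd, map_add, smul_add,
      WithLp.ofLp_add, blockMat_add]
  map_smul' r z := by
    rw [RingHom.id_apply, ← map_smul]
    congr 1
    ext1
    simp only [selfAdjoint.val_smul, WithLp.smul_fst, WithLp.smul_snd, map_smul,
      smul_comm _ r, WithLp.ofLp_smul, blockMat_smul]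
  norm_map' z := by
    change ‖T'.symm _‖ = _
    rw [← sq_eq_sq₀ (norm_nonneg _) (norm_nonneg _), hT',
      LinearEquiv.apply_symm_apply, re_trace_blockMat, ← EuclideanSpace.norm_sq_eq, norm_smul,
      ← hT, WithLp.prod_norm_sq_eq_of_L2, WithLp.prod_norm_sq_eq_of_L2, mul_pow, norm_inv,
      Real.norm_of_nonneg (Real.sqrt_nonneg _), inv_pow, Real.sq_sqrt zero_le_two,
      mul_inv_cancel_left₀ two_ne_zero, Real.norm_eq_abs, sq_abs, add_assoc]

theorem lintegral_detWeight_succ [MeasurableSpace 𝕜] [BorelSpace 𝕜] {E E' : Type*}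
    [NormedAddCommGroup E] [InnerProductSpace ℝ E] [FiniteDimensional ℝ E] [MeasurableSpace E]
    [BorelSpace E] [NormedAddCommGroup E'] [InnerProductSpace ℝ E'] [FiniteDimensional ℝ E']
    [MeasurableSpace E'] [BorelSpace E']
    (T : E ≃ₗ[ℝ] HMat 𝕜 n) (hT : ∀ y, ‖y‖ ^ 2 = RCLike.re ((T y).val * ((T y).val)ᴴ).trace)
    (T' : E' ≃ₗ[ℝ] HMat 𝕜 (n + 1))
    (hT' : ∀ y, ‖y‖ ^ 2 = RCLike.re ((T' y).val * ((T' y).val)ᴴ).trace)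
    (hdim : Module.finrank ℝ E' = Module.finrank ℝ E + Module.finrank ℝ 𝕜 * n + 1)
    {a b : ℝ} (ha : 0 ≤ a) (hb : (Module.finrank ℝ 𝕜 : ℝ) = 2 * b) :
    ∫⁻ y, detWeight a (T' y).val =
      ENNReal.ofReal (stepConst b n a) * ∫⁻ y, detWeight (a + b) (T y).val := by
  have hfin : Module.finrank ℝ (WithLp 2 (E × WithLp 2 (EuclideanSpace 𝕜 (Fin n) × ℝ))) =
      Module.finrank ℝ E' := by
    rw [hdim, (WithLp.linearEquiv 2 ℝ _).finrank_eq, Module.finrank_prod,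
      (WithLp.linearEquiv 2 ℝ _).finrank_eq, Module.finrank_prod,
      ← Module.finrank_mul_finrank ℝ 𝕜 (EuclideanSpace 𝕜 (Fin n)), finrank_euclideanSpace_fin,
      Module.finrank_self, add_assoc]
  let Φ := (blockIsometry T hT T' hT').toLinearIsometryEquiv hfin
  have hcont : Continuous fun y => (T' y).val :=
    (valLinearMap T'.toLinearMap).continuous_of_finiteDimensional
  have hmeas : Measurable fun y => detWeight a (T' y).val := measurable_detWeight hcont a
  have hΦ : Measurable fun z => detWeight a (T' (Φ z)).val := hmeas.comp Φ.continuous.measurable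
  have hΦ₁ : Measurable fun z => detWeight a (T' (Φ (WithLp.toLp 2 z))).val :=
    hΦ.comp (WithLp.measurable_toLp 2 _)
  have hΦ₂ (y : E) : Measurable fun u => detWeight a (T' (Φ (WithLp.toLp 2 (y, u)))).val :=
    hΦ₁.comp measurable_prodMk_left
  have hΦ₃ (y : E) : Measurable fun u =>
      detWeight a (T' (Φ (WithLp.toLp 2 (y, WithLp.toLp 2 u)))).val :=
    (hΦ₂ y).comp (WithLp.measurable_toLp 2 _)
  have hval (y : E) (w : EuclideanSpace 𝕜 (Fin n)) (x : ℝ) :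
      (T' (Φ (WithLp.toLp 2 (y, WithLp.toLp 2 (w, x))))).val =
        blockMat (T y).val ((√2)⁻¹ • w).ofLp x := by
    change (T' (T'.symm _)).val = _
    rw [LinearEquiv.apply_symm_apply]
    rfl
  rw [← Φ.measurePreserving.lintegral_comp hmeas,
    ← (WithLp.volume_preserving_toLp E _).lintegral_comp hΦ, Measure.volume_eq_prod,
    lintegral_prod _ hΦ₁.aemeasurable,
    ← lintegral_const_mul' _ _ ENNReal.ofReal_ne_top]
  refine lintegral_congr fun y => ?_
  rw [← (WithLp.volume_preserving_toLp _ ℝ).lintegral_comp (hΦ₂ y), Measure.volume_eq_prod,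
    lintegral_prod _ (hΦ₃ y).aemeasurable,
    ← lintegral_lintegral_detWeight_blockMat _ ha hb]
  simp_rw [hval]

end Recursion

section Ball

open scoped ComplexOrder

variable {𝕜 : Type} [RCLike 𝕜] {n : ℕ}

theorem detWeight_of_size_zero (a : ℝ) (A : Matrix (Fin 0) (Fin 0) 𝕜) : detWeight a A = 1 := by
  rw [detWeight, Subsingleton.elim (1 + A) 1, Subsingleton.elim (1 - A) 1,
    if_pos ⟨PosDef.one, PosDef.one⟩]
  simp

theorem lintegral_detWeight_eq_matBeta [MeasurableSpace 𝕜] [BorelSpace 𝕜]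
    (β : ℕ) (hβ : Module.finrank ℝ 𝕜 = β)
    (T : ∀ n : ℕ, EuclideanSpace ℝ (Fin (β * (n * (n - 1) / 2) + n)) ≃ₗ[ℝ] HMat 𝕜 n)
    (hT : ∀ n y, ‖y‖ ^ 2 = RCLike.re ((T n y).val * ((T n y).val)ᴴ).trace)
    (n : ℕ) {a : ℝ} (ha : 0 ≤ a) :
    ∫⁻ y, detWeight a (T n y).val = ENNReal.ofReal (matBeta (β / 2) n a) := by
  have hβ0 : (0 : ℝ) < β / 2 := by
    have : (0 : ℝ) < β := Nat.cast_pos.2 (hβ ▸ Module.finrank_pos)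
    positivity
  induction n generalizing a with
  | zero =>
    have : IsEmpty (Fin (β * (0 * (0 - 1) / 2) + 0)) := by simp [Fin.isEmpty]
    simp_rw [detWeight_of_size_zero]
    rw [volume_euclideanSpace_eq_dirac]
    simp [matBeta]
  | succ n ih =>
    rw [lintegral_detWeight_succ (T n) (hT n) (T (n + 1)) (hT (n + 1)) _ ha (b := β / 2)
      (by rw [hβ]; ring), ih (by linarith), matBeta, ENNReal.ofReal_mul (stepConst_pos hβ0 n ha).le]
    rw [finrank_euclideanSpace_fin, finrank_euclideanSpace_fin, hβ, Nat.triangle_succ]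
    ring

theorem posSemidef_one_add_iff {A : Matrix (Fin n) (Fin n) 𝕜} (hA : A.IsHermitian) :
    (1 + A).PosSemidef ↔ ∀ j, -1 ≤ hA.eigenvalues j := by
  rw [posSemidef_iff_isHermitian_and_spectrum_nonneg, ← map_one (algebraMap 𝕜 _),
    ← spectrum.singleton_add_eq, hA.spectrum_eq_image_range, map_one,
    and_iff_right (isHermitian_one.add hA), Set.singleton_add, Set.image_subset_iff,
    Set.image_subset_iff, Set.range_subset_iff]
  refine forall_congr' fun j => ?_
  change (0 : 𝕜) ≤ 1 + ((hA.eigenvalues j : ℝ) : 𝕜) ↔ _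
  rw [← RCLike.ofReal_one, ← RCLike.ofReal_add, RCLike.ofReal_nonneg, neg_le_iff_add_nonneg']

theorem posSemidef_one_sub_iff {A : Matrix (Fin n) (Fin n) 𝕜} (hA : A.IsHermitian) :
    (1 - A).PosSemidef ↔ ∀ j, hA.eigenvalues j ≤ 1 := by
  rw [posSemidef_iff_isHermitian_and_spectrum_nonneg, ← map_one (algebraMap 𝕜 _),
    ← spectrum.singleton_sub_eq, hA.spectrum_eq_image_range, map_one,
    and_iff_right (isHermitian_one.sub hA), Set.singleton_sub, Set.image_subset_iff,
    Set.image_subset_iff, Set.range_subset_iff]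
  refine forall_congr' fun j => ?_
  change (0 : 𝕜) ≤ 1 - ((hA.eigenvalues j : ℝ) : 𝕜) ↔ _
  rw [← RCLike.ofReal_one, ← RCLike.ofReal_sub, RCLike.ofReal_nonneg, sub_nonneg]

theorem mem_matBallInf_iff (A : HMat 𝕜 n) :
    A ∈ matBallInf 𝕜 n ↔ (1 + A.val).PosSemidef ∧ (1 - A.val).PosSemidef := by
  rw [posSemidef_one_add_iff A.prop, posSemidef_one_sub_iff A.prop, ← forall_and]
  exact forall_congr' fun j => abs_le

theorem posDef_one_add_smul {A : Matrix (Fin n) (Fin n) 𝕜} (hA : (1 + A).PosSemidef) {r : ℝ}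
    (hr0 : 0 ≤ r) (hr1 : r < 1) : (1 + r • A).PosDef := by
  have : 1 + r • A = (1 - r) • (1 : Matrix (Fin n) (Fin n) 𝕜) + r • (1 + A) := by
    rw [smul_add, sub_smul, one_smul]; abel
  rw [this]
  exact (PosDef.one.smul (sub_pos.2 hr1)).add_posSemidef (hA.smul hr0)

theorem volume_posSemidef_eq_volume_posDef {E : Type*} [NormedAddCommGroup E]
    [InnerProductSpace ℝ E] [FiniteDimensional ℝ E] [MeasurableSpace E] [BorelSpace E]
    (f : E →ₗ[ℝ] Matrix (Fin n) (Fin n) 𝕜)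
    (hfin : volume {y | (1 + f y).PosDef ∧ (1 - f y).PosDef} ≠ ∞) :
    volume {y | (1 + f y).PosSemidef ∧ (1 - f y).PosSemidef} =
      volume {y | (1 + f y).PosDef ∧ (1 - f y).PosDef} := by
  refine le_antisymm ?_ (measure_mono fun y hy => ⟨hy.1.posSemidef, hy.2.posSemidef⟩)
  set S := {y | (1 + f y).PosDef ∧ (1 - f y).PosDef}
  have hlim : Tendsto (fun r : ℝ => ENNReal.ofReal |r ^ Module.finrank ℝ E| * volume S)
      (nhdsWithin 1 (Set.Ioi 1)) (nhds (ENNReal.ofReal |1 ^ Module.finrank ℝ E| * volume S)) := by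
    refine ENNReal.Tendsto.mul_const ?_ (Or.inr hfin)
    exact (ENNReal.continuous_ofReal.comp (continuous_pow _).abs).tendsto 1 |>.mono_left
      nhdsWithin_le_nhds
  rw [one_pow, abs_one, ENNReal.ofReal_one, one_mul] at hlim
  refine ge_of_tendsto hlim ?_
  filter_upwards [self_mem_nhdsWithin] with r hr
  have hr0 : (0 : ℝ) < r := one_pos.trans hr
  rw [← Measure.addHaar_smul]
  refine measure_mono fun y hy => ?_
  rw [Set.mem_smul_set_iff_inv_smul_mem₀ hr0.ne']
  have hr1 : r⁻¹ < 1 := inv_lt_one_of_one_lt₀ hr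
  refine ⟨?_, ?_⟩
  · rw [map_smul]
    exact posDef_one_add_smul hy.1 (inv_nonneg.2 hr0.le) hr1
  · rw [map_smul, sub_eq_add_neg, ← smul_neg]
    exact posDef_one_add_smul (sub_eq_add_neg 1 (f y) ▸ hy.2) (inv_nonneg.2 hr0.le) hr1

theorem volume_matBallInf [MeasurableSpace 𝕜] [BorelSpace 𝕜]
    (β : ℕ) (hβ : Module.finrank ℝ 𝕜 = β)
    (T : ∀ n : ℕ, EuclideanSpace ℝ (Fin (β * (n * (n - 1) / 2) + n)) ≃ₗ[ℝ] HMat 𝕜 n)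
    (hT : ∀ n y, ‖y‖ ^ 2 = RCLike.re ((T n y).val * ((T n y).val)ᴴ).trace) (n : ℕ) :
    (volume.map (T n)) (matBallInf 𝕜 n) = ENNReal.ofReal (matBeta (β / 2) n 0) := by
  have : BorelSpace (Matrix (Fin n) (Fin n) 𝕜) := inferInstanceAs (BorelSpace (Fin n → Fin n → 𝕜))
  have hcont : Continuous fun y => (T n y).val :=
    (valLinearMap (T n).toLinearMap).continuous_of_finiteDimensional
  have hball : MeasurableSet (matBallInf 𝕜 n) := by
    rw [Set.ext mem_matBallInf_iff]
    exact ((isClosed_setOf_posSemidef.preimage (continuous_const.add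
      continuous_subtype_val)).inter (isClosed_setOf_posSemidef.preimage (continuous_const.sub
      continuous_subtype_val))).measurableSet
  rw [Measure.map_apply (hcont.subtype_mk _).measurable hball]
  have hmeas : MeasurableSet {y | (1 + (T n y).val).PosDef ∧ (1 - (T n y).val).PosDef} :=
    (measurableSet_posDef (continuous_const.add hcont)).inter
      (measurableSet_posDef (continuous_const.sub hcont))
  have hopen : volume {y | (1 + (T n y).val).PosDef ∧ (1 - (T n y).val).PosDef} =
      ENNReal.ofReal (matBeta (β / 2) n 0) := by
    rw [← lintegral_detWeight_eq_matBeta β hβ T hT n le_rfl, ← lintegral_indicator_one hmeas]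
    refine lintegral_congr fun y => ?_
    by_cases h : (1 + (T n y).val).PosDef ∧ (1 - (T n y).val).PosDef
    · refine (Set.indicator_of_mem (s := {y | _ ∧ _}) h 1).trans ?_
      simp [detWeight, h]
    · refine (Set.indicator_of_notMem (s := {y | _ ∧ _}) h 1).trans ?_
      rw [detWeight, if_neg h]
  rw [← hopen]
  refine Eq.trans ?_ (volume_posSemidef_eq_volume_posDef (valLinearMap (T n).toLinearMap)
    (hopen.trans_ne ENNReal.ofReal_ne_top))
  exact congrArg volume (Set.ext fun y => mem_matBallInf_iff (T n y))

end Ball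

theorem stmt2 (𝕜 : Type) [RCLike 𝕜] [MeasurableSpace 𝕜] [BorelSpace 𝕜]
    (β : ℕ) (hβ : Module.finrank ℝ 𝕜 = β)
    -- `vol n` is the Lebesgue volume on `H_n(F_β)` induced by the inner product
    -- `⟨A,B⟩ = Re Tr (A Bᴴ)`, i.e. the pushforward of the Lebesgue measure on the
    -- Euclidean space of dimension `N = β n(n-1)/2 + n` under any linear isometry `T n`.
    (vol : ∀ n : ℕ, Measure (HMat 𝕜 n))
    (T : ∀ n : ℕ, EuclideanSpace ℝ (Fin (β * (n * (n - 1) / 2) + n)) ≃ₗ[ℝ] HMat 𝕜 n)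
    (hT : ∀ n x y, ⟪x, y⟫ = RCLike.re (Matrix.trace ((T n x).val * ((T n y).val)ᴴ)))
    (hvol : ∀ n, vol n = Measure.map (T n) volume) :
    Tendsto
      (fun n : ℕ => (n : ℝ) ^ ((1 : ℝ) / 2) *
        ((vol n) (matBallInf 𝕜 n)).toReal ^ (2 / ((β : ℝ) * (n : ℝ) ^ 2)))
      atTop
      (nhds ((Real.pi / (β : ℝ)) ^ ((1 : ℝ) / 2) * Real.exp (3 / 4))) := by
  have hpos : 0 < β := hβ ▸ Module.finrank_pos
  have hle : β ≤ 2 := hβ ▸ RCLike.finrank_le_two 𝕜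
  have hβ0 : (0 : ℝ) < β / 2 := by positivity
  have he : (β : ℝ) / 2 * (1 + (2 - β : ℕ)) = 1 := by
    interval_cases β <;> norm_num
  refine Tendsto.congr (fun n => ?_)
    ((tendsto_matBeta hβ0 (by omega : 2 - β ≤ 1) he).trans_eq ?_)
  · rw [hvol, volume_matBallInf β hβ T fun n y => by rw [← hT, real_inner_self_eq_norm_sq],
      ENNReal.toReal_ofReal (matBeta_pos hβ0 n le_rfl).le]
    congr 2
    field_simp
  · rw [mul_div_cancel₀ _ two_ne_zero]

end
end

section
/- Let 0 < p < ∞, m ≥ 0, and let f : ℝ^n → [0,∞) be Borel measurable, homogeneous of degree m (f(tx) = t^m f(x) for all t ≥ 0, x ∈ ℝ^n), not almost everywhere zero, and such that 0 < ∫_{ℝ^n} e^{−‖x‖_p^p} f(x) dx < ∞. Let X = (X_1,…,X_n) be a random vector with Lebesgue density x ↦ C_{p,f,n} e^{−‖x‖_p^p} f(x), where C_{p,f,n} is the normalization constant. Then the random vector X/‖X‖_p is independent of the random variable ‖X‖_p, and X/‖X‖_p has density x ↦ c_{p,f,n} f(x) with respect to the cone probability measure μ_{B_p^n} on S_p^{n−1},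 for a suitable normalization constant c_{p,f,n} ∈ (0,∞). -/
open MeasureTheory ENNReal

set_option autoImplicit false

noncomputable section

/-- The `p`-norm `‖x‖_p = (Σ_i |x_i|^p)^{1/p}` on `ℝ^n`. -/
def pNorm {n : ℕ} (p : ℝ) (x : Fin n → ℝ) : ℝ :=
  (∑ i, |x i| ^ p) ^ (1 / p)

/-- The radial projection `x ↦ x/‖x‖_p` onto the sphere `S_p^{n-1}`. -/
def pProj {n : ℕ} (p : ℝ) (x : Fin n → ℝ) : Fin n → ℝ :=
  (pNorm p x)⁻¹ • x

/-- The cone probability measure `μ_{B_p^n}` on `S_p^{n-1}`, realized as a measure on `ℝ^n`: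
`μ_{B_p^n}(A) = vol_n({r x : r ∈ [0,1], x ∈ A})/vol_n(B_p^n)`, which is the image of the
normalized Lebesgue measure on `B_p^n` under the radial projection `x ↦ x/‖x‖_p`. -/
def coneMeasure (n : ℕ) (p : ℝ) : Measure (Fin n → ℝ) :=
  Measure.map (pProj p)
    ((volume {x : Fin n → ℝ | ∑ i, |x i| ^ p ≤ 1})⁻¹ •
      volume.restrict {x : Fin n → ℝ | ∑ i, |x i| ^ p ≤ 1})

lemma pNorm_nonneg {n : ℕ} (p : ℝ) (x : Fin n → ℝ) : 0 ≤ pNorm p x :=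
  Real.rpow_nonneg (Finset.sum_nonneg fun _ _ => Real.rpow_nonneg (abs_nonneg _) _) _

lemma pNorm_smul {n : ℕ} {p : ℝ} (hp : 0 < p) {t : ℝ} (ht : 0 ≤ t) (x : Fin n → ℝ) :
    pNorm p (t • x) = t * pNorm p x := by
  have hsum : 0 ≤ ∑ i, |x i| ^ p :=
    Finset.sum_nonneg fun _ _ => Real.rpow_nonneg (abs_nonneg _) _
  simp only [pNorm, Pi.smul_apply, smul_eq_mul, abs_mul, abs_of_nonneg ht,
    Real.mul_rpow ht (abs_nonneg _), ← Finset.mul_sum]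
  rw [Real.mul_rpow (Real.rpow_nonneg ht _) hsum, ← Real.rpow_mul ht, mul_one_div_cancel hp.ne',
    Real.rpow_one]

lemma pNorm_rpow {n : ℕ} {p : ℝ} (hp : 0 < p) (x : Fin n → ℝ) :
    pNorm p x ^ p = ∑ i, |x i| ^ p := by
  rw [pNorm, ← Real.rpow_mul (Finset.sum_nonneg fun _ _ => Real.rpow_nonneg (abs_nonneg _) _),
    one_div_mul_cancel hp.ne', Real.rpow_one]

lemma abs_apply_le_pNorm {n : ℕ} {p : ℝ} (hp : 0 < p) (x : Fin n → ℝ) (i : Fin n) :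
    |x i| ≤ pNorm p x := by
  rw [← Real.rpow_le_rpow_iff (abs_nonneg _) (pNorm_nonneg p x) hp, pNorm_rpow hp]
  exact Finset.single_le_sum (f := fun i => |x i| ^ p)
    (fun _ _ => Real.rpow_nonneg (abs_nonneg _) _) (Finset.mem_univ i)

lemma eq_zero_of_pNorm_eq_zero {n : ℕ} {p : ℝ} (hp : 0 < p) {x : Fin n → ℝ}
    (hx : pNorm p x = 0) : x = 0 := by
  ext i
  exact abs_nonpos_iff.1 ((abs_apply_le_pNorm hp x i).trans hx.le)

lemma continuous_pNorm {n : ℕ} {p : ℝ} (hp : 0 < p) :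
    Continuous (pNorm p : (Fin n → ℝ) → ℝ) := by
  unfold pNorm
  refine Continuous.rpow_const ?_ fun _ => Or.inr (by positivity)
  exact continuous_finsetSum _ fun i _ =>
    (continuous_apply i).abs.rpow_const fun _ => Or.inr hp.le

lemma measurable_pProj {n : ℕ} {p : ℝ} (hp : 0 < p) :
    Measurable (pProj p : (Fin n → ℝ) → Fin n → ℝ) :=
  (continuous_pNorm hp).measurable.inv.smul measurable_id

lemma pNorm_smul_pProj {n : ℕ} {p : ℝ} (hp : 0 < p) (x : Fin n → ℝ) :
    pNorm p x • pProj p x = x := by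
  rcases eq_or_ne (pNorm p x) 0 with h | h
  · rw [h, zero_smul, eq_zero_of_pNorm_eq_zero hp h]
  · rw [pProj, smul_inv_smul₀ h]

lemma pProj_smul {n : ℕ} {p : ℝ} (hp : 0 < p) {t : ℝ} (ht : 0 < t) (x : Fin n → ℝ) :
    pProj p (t • x) = pProj p x := by
  rw [pProj, pProj, pNorm_smul hp ht.le, smul_smul, mul_inv_rev, mul_assoc,
    inv_mul_cancel₀ ht.ne', mul_one]

lemma setOf_sum_rpow_le_one {n : ℕ} {p : ℝ} (hp : 0 < p) :
    {x : Fin n → ℝ | ∑ i, |x i| ^ p ≤ 1} = pNorm p ⁻¹' Set.Iic 1 := by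
  ext x
  rw [Set.mem_ofPred_eq, Set.mem_preimage, Set.mem_Iic,
    ← Real.rpow_le_rpow_iff (pNorm_nonneg p x) zero_le_one hp, pNorm_rpow hp, Real.one_rpow]

lemma volume_pNorm_le_one_ne_top (n : ℕ) {p : ℝ} (hp : 0 < p) :
    volume (pNorm p ⁻¹' Set.Iic 1 : Set (Fin n → ℝ)) ≠ ∞ := by
  refine ((measure_mono ?_).trans_lt
    (measure_closedBall_lt_top (x := (0 : Fin n → ℝ)) (r := 1))).ne
  intro x hx
  rw [mem_closedBall_zero_iff, pi_norm_le_iff_of_nonneg zero_le_one]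
  exact fun i => (abs_apply_le_pNorm hp x i).trans hx

lemma volume_pNorm_le_one_ne_zero (n : ℕ) {p : ℝ} (hp : 0 < p) :
    volume (pNorm p ⁻¹' Set.Iic 1 : Set (Fin n → ℝ)) ≠ 0 := by
  refine (Measure.measure_pos_of_mem_nhds volume (x := 0) ?_).ne'
  have h0 : pNorm p (0 : Fin n → ℝ) = 0 := by
    simpa using pNorm_smul hp le_rfl (0 : Fin n → ℝ)
  exact (continuous_pNorm hp).continuousAt.preimage_mem_nhds
    (by rw [h0]; exact Iic_mem_nhds zero_lt_one)

lemma coneMeasure_apply {n : ℕ} {p : ℝ} (hp : 0 < p) {s : Set (Fin n → ℝ)}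
    (hs : MeasurableSet s) :
    coneMeasure n p s = (volume (pNorm p ⁻¹' Set.Iic 1 : Set (Fin n → ℝ)))⁻¹ *
      volume (pProj p ⁻¹' s ∩ pNorm p ⁻¹' Set.Iic 1) := by
  rw [coneMeasure, Measure.map_apply (measurable_pProj hp) hs, setOf_sum_rpow_le_one hp,
    Measure.smul_apply, Measure.restrict_apply (measurable_pProj hp hs), smul_eq_mul]

lemma isProbabilityMeasure_coneMeasure (n : ℕ) {p : ℝ} (hp : 0 < p) :
    IsProbabilityMeasure (coneMeasure n p) where
  measure_univ := by
    rw [coneMeasure_apply hp .univ, Set.preimage_univ, Set.univ_inter]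
    exact ENNReal.inv_mul_cancel (volume_pNorm_le_one_ne_zero n hp)
      (volume_pNorm_le_one_ne_top n hp)

lemma volume_pProj_preimage_inter_pNorm_le {n : ℕ} {p : ℝ} (hp : 0 < p) (s : Set (Fin n → ℝ))
    {r : ℝ} (hr : 0 < r) :
    volume (pProj p ⁻¹' s ∩ pNorm p ⁻¹' Set.Iic r) =
      ENNReal.ofReal (r ^ n) * volume (pProj p ⁻¹' s ∩ pNorm p ⁻¹' Set.Iic 1) := by
  have : pProj p ⁻¹' s ∩ pNorm p ⁻¹' Set.Iic r =
      (r⁻¹ • ·) ⁻¹' (pProj p ⁻¹' s ∩ pNorm p ⁻¹' Set.Iic 1) := by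
    ext x
    simp only [Set.mem_inter_iff, Set.mem_preimage, Set.mem_Iic, pProj_smul hp (inv_pos.2 hr),
      pNorm_smul hp (inv_pos.2 hr).le, inv_mul_le_one₀ hr]
  rw [this, Measure.addHaar_preimage_smul volume (inv_ne_zero hr.ne'), Module.finrank_fin_fun,
    inv_pow, inv_inv, abs_of_pos (pow_pos hr n)]

lemma volume_pNorm_le {n : ℕ} {p : ℝ} (hp : 0 < p) {r : ℝ} (hr : 0 < r) :
    volume (pNorm p ⁻¹' Set.Iic r : Set (Fin n → ℝ)) =
      ENNReal.ofReal (r ^ n) * volume (pNorm p ⁻¹' Set.Iic 1 : Set (Fin n → ℝ)) := by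
  simpa using volume_pProj_preimage_inter_pNorm_le hp (Set.univ : Set (Fin n → ℝ)) hr

lemma volume_pNorm_le_of_nonpos {n : ℕ} (hn : 0 < n) {p : ℝ} (hp : 0 < p) {r : ℝ} (hr : r ≤ 0) :
    volume (pNorm p ⁻¹' Set.Iic r : Set (Fin n → ℝ)) = 0 := by
  have : Nonempty (Fin n) := ⟨⟨0, hn⟩⟩
  refine measure_mono_null (fun x hx => ?_) (measure_singleton (0 : Fin n → ℝ))
  exact eq_zero_of_pNorm_eq_zero hp (le_antisymm (le_trans hx hr) (pNorm_nonneg p x))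

/-- Polar decomposition of Lebesgue measure with respect to the `p`-norm. -/
lemma map_pProj_pNorm_volume {n : ℕ} (hn : 0 < n) {p : ℝ} (hp : 0 < p) :
    Measure.map (fun x : Fin n → ℝ => (pProj p x, pNorm p x)) volume =
      (coneMeasure n p).prod (Measure.map (pNorm p : (Fin n → ℝ) → ℝ) volume) := by
  have := isProbabilityMeasure_coneMeasure n hp
  have hN : Measurable (pNorm p : (Fin n → ℝ) → ℝ) := (continuous_pNorm hp).measurable
  refine (Measure.prod_eq_generateFrom MeasurableSpace.generateFrom_measurableSet
    ((borel_eq_generateFrom_Iic ℝ).symm.trans BorelSpace.measurable_eq.symm)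
    MeasurableSpace.isPiSystem_measurableSet isPiSystem_Iic
    (coneMeasure n p).toFiniteSpanningSetsIn ?_
    fun s hs => Set.forall_mem_range.2 fun r => ?_).symm
  · refine ⟨fun k => Set.Iic ((k : ℝ) + 1), fun k => ⟨_, rfl⟩, fun k => ?_, ?_⟩
    · rw [Measure.map_apply hN measurableSet_Iic, volume_pNorm_le hp (by positivity)]
      exact ENNReal.mul_lt_top ofReal_lt_top (volume_pNorm_le_one_ne_top n hp).lt_top
    · refine Set.eq_univ_of_forall fun x => Set.mem_iUnion.2 ?_
      obtain ⟨k, hk⟩ := exists_nat_ge x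
      exact ⟨k, hk.trans (by simp)⟩
  · have hs' : MeasurableSet s := hs
    rw [Measure.map_apply ((measurable_pProj hp).prodMk hN) (hs'.prod measurableSet_Iic),
      Measure.map_apply hN measurableSet_Iic, Set.mk_preimage_prod]
    rcases le_or_gt r 0 with hr | hr
    · rw [volume_pNorm_le_of_nonpos hn hp hr, mul_zero]
      exact measure_mono_null Set.inter_subset_right (volume_pNorm_le_of_nonpos hn hp hr)
    · rw [volume_pProj_preimage_inter_pNorm_le hp s hr, volume_pNorm_le hp hr,
        coneMeasure_apply hp hs', mul_comm (_⁻¹), mul_left_comm, mul_assoc,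
        ENNReal.inv_mul_cancel (volume_pNorm_le_one_ne_zero n hp)
          (volume_pNorm_le_one_ne_top n hp), mul_one]

lemma map_withDensity_comp {α β : Type*} [MeasurableSpace α] [MeasurableSpace β]
    {μ : Measure α} {g : α → β} (hg : Measurable g) {φ : β → ℝ≥0∞} (hφ : Measurable φ) :
    Measure.map g (μ.withDensity fun x => φ (g x)) = (Measure.map g μ).withDensity φ := by
  ext s hs
  rw [Measure.map_apply hg hs, withDensity_apply _ (hg hs), withDensity_apply _ hs,
    setLIntegral_map hs hφ hg]

/-- A probability measure of product form is the product of its marginals. -/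
lemma prod_eq_prod_map_fst_map_snd {α β : Type*} [MeasurableSpace α] [MeasurableSpace β]
    (κ : Measure α) (τ : Measure β) [SFinite κ] [SFinite τ] [IsProbabilityMeasure (κ.prod τ)] :
    κ.prod τ = (Measure.map Prod.fst (κ.prod τ)).prod (Measure.map Prod.snd (κ.prod τ)) := by
  have h : κ Set.univ * τ Set.univ = 1 := by
    rw [← Measure.prod_prod, Set.univ_prod_univ, measure_univ]
  rw [Measure.map_fst_prod, Measure.map_snd_prod, Measure.prod_smul_left,
    Measure.prod_smul_right, smul_smul, mul_comm, h, one_smul]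

theorem stmt11 (n : ℕ) (hn : 0 < n) (p : ℝ) (hp : 0 < p) (m : ℝ) (hm : 0 ≤ m)
    (f : (Fin n → ℝ) → ℝ) (hf_meas : Measurable f) (hf_nonneg : ∀ x, 0 ≤ f x)
    (hf_hom : ∀ t : ℝ, 0 ≤ t → ∀ x, f (t • x) = t ^ m * f x)
    (hf_int : Integrable (fun x : Fin n → ℝ => Real.exp (-∑ i, |x i| ^ p) * f x))
    (hf_pos : 0 < ∫ x : Fin n → ℝ, Real.exp (-∑ i, |x i| ^ p) * f x)
    -- `μX` is the law of `X`, with density `x ↦ C e^{-‖x‖_p^p} f(x)`,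
    -- `C` being the normalization constant
    (C : ℝ) (μX : Measure (Fin n → ℝ))
    (hμX : μX = volume.withDensity fun x : Fin n → ℝ =>
      ENNReal.ofReal (C * (Real.exp (-∑ i, |x i| ^ p) * f x)))
    (hprob : IsProbabilityMeasure μX) :
    -- `X/‖X‖_p` and `‖X‖_p` are independent …
    Measure.map (fun x : Fin n → ℝ => (pProj p x, pNorm p x)) μX =
      (Measure.map (pProj p) μX).prod (Measure.map (pNorm p) μX) ∧
    -- … and `X/‖X‖_p` has density `c · f` with respect to the cone measure on `S_p^{n-1}`
    ∃ c : ℝ, 0 < c ∧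
      Measure.map (pProj p) μX =
        (coneMeasure n p).withDensity fun x => ENNReal.ofReal (c * f x) := by
  have hN : Measurable (pNorm p : (Fin n → ℝ) → ℝ) := (continuous_pNorm hp).measurable
  have hπ : Measurable (pProj p : (Fin n → ℝ) → Fin n → ℝ) := measurable_pProj hp
  have := isProbabilityMeasure_coneMeasure n hp
  have hC : 0 < C := by
    by_contra! hC
    refine hprob.ne_zero _ ?_
    simp only [hμX, ofReal_of_nonpos (mul_nonpos_of_nonpos_of_nonneg hC
      (mul_nonneg (Real.exp_pos _).le (hf_nonneg _)))]
    exact withDensity_zero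
  set F : (Fin n → ℝ) → ℝ≥0∞ := fun x => ENNReal.ofReal (f x)
  set g : ℝ → ℝ≥0∞ := fun r => ENNReal.ofReal (C * (Real.exp (-r ^ p) * r ^ m))
  have hF : Measurable F := hf_meas.ennreal_ofReal
  have hg : Measurable g := by fun_prop
  set κ := (coneMeasure n p).withDensity F
  set τ := (Measure.map (pNorm p : (Fin n → ℝ) → ℝ) volume).withDensity g
  have hdens : ∀ x : Fin n → ℝ, ENNReal.ofReal (C * (Real.exp (-∑ i, |x i| ^ p) * f x)) =
      F (pProj p x) * g (pNorm p x) := fun x => by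
    rw [← ENNReal.ofReal_mul (hf_nonneg _), pNorm_rpow hp]
    conv_lhs => rw [← pNorm_smul_pProj hp x, hf_hom _ (pNorm_nonneg p x), pNorm_smul_pProj hp x]
    congr 1
    ring
  have hpair : Measurable fun x : Fin n → ℝ => (pProj p x, pNorm p x) := hπ.prodMk hN
  have hjoint : Measure.map (fun x : Fin n → ℝ => (pProj p x, pNorm p x)) μX = κ.prod τ := by
    rw [prod_withDensity hF hg, ← map_pProj_pNorm_volume hn hp, hμX, funext hdens]
    exact map_withDensity_comp hpair
      (φ := fun z : (Fin n → ℝ) × ℝ => F z.1 * g z.2) (by fun_prop)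
  have hprod : IsProbabilityMeasure (κ.prod τ) :=
    hjoint ▸ Measure.isProbabilityMeasure_map hpair.aemeasurable
  have hfst : Measure.map (pProj p) μX = Measure.map Prod.fst (κ.prod τ) := by
    rw [← hjoint, Measure.map_map measurable_fst hpair]; rfl
  have hsnd : Measure.map (pNorm p) μX = Measure.map Prod.snd (κ.prod τ) := by
    rw [← hjoint, Measure.map_map measurable_snd hpair]; rfl
  refine ⟨by rw [hjoint, hfst, hsnd]; exact prod_eq_prod_map_fst_map_snd κ τ, ?_⟩
  have hmass : κ Set.univ * τ Set.univ = 1 := by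
    rw [← Measure.prod_prod, Set.univ_prod_univ, measure_univ]
  have hτ0 : τ Set.univ ≠ 0 := right_ne_zero_of_mul (hmass ▸ one_ne_zero)
  have hτ_top : τ Set.univ ≠ ∞ := fun h => by
    rw [h, ENNReal.mul_top (left_ne_zero_of_mul (hmass ▸ one_ne_zero))] at hmass
    exact top_ne_one hmass
  refine ⟨(τ Set.univ).toReal, toReal_pos hτ0 hτ_top, ?_⟩
  rw [hfst, Measure.map_fst_prod, ← withDensity_smul _ hF]
  congr 1
  ext x
  rw [ENNReal.ofReal_mul toReal_nonneg, ofReal_toReal hτ_top, Pi.smul_apply, smul_eq_mul]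

end
end

section
/- For every p > 0, ∫_{−1}^1 ∫_{−1}^1 h_p(x) h_p(y) log|x−y| dx dy = −log 2 − 1/(2p). -/
open MeasureTheory

set_option autoImplicit false

noncomputable section

/-- The Ullman density `h_p`. -/
def ullmanDensity (p x : ℝ) : ℝ :=
  if |x| ≤ 1 then (p / Real.pi) * ∫ t in Set.Ioo |x| 1, t ^ (p - 1) / Real.sqrt (t ^ 2 - x ^ 2)
  else 0

open Real Set
open scoped ENNReal

lemma two_mul_abs_mul_cos_sub_eq_norm_mul_norm {t : ℝ} (ht : 0 < t) (x θ : ℝ) (a : ℂ)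
    (ha : a.re = x) (hna : ‖a‖ = t) :
    t * (2 * |t * cos θ - x|) =
      ‖circleMap 0 t θ - a‖ * ‖circleMap 0 t θ - (starRingEnd ℂ) a‖ := by
  have hz : ‖circleMap 0 t θ‖ = t := by simp [abs_of_pos ht]
  have hsq : a.re ^ 2 + a.im ^ 2 = t ^ 2 := by
    rw [← hna, ← Complex.normSq_eq_norm_sq, Complex.normSq_apply]; ring
  have key : (circleMap 0 t θ - a) * (circleMap 0 t θ - (starRingEnd ℂ) a)
      = circleMap 0 t θ * ((2 * (t * cos θ - x) : ℝ) : ℂ) := by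
    have hs := sin_sq_add_cos_sq θ
    subst ha
    apply Complex.ext
    · simp [circleMap, Complex.exp_ofReal_mul_I_re, Complex.exp_ofReal_mul_I_im]
      rw [Complex.cos_ofReal_re]
      linear_combination hsq - t ^ 2 * hs
    · simp [circleMap, Complex.exp_ofReal_mul_I_re, Complex.exp_ofReal_mul_I_im]
      rw [Complex.cos_ofReal_re]
      ring
  rw [← norm_mul, key, norm_mul, hz, Complex.norm_real, norm_eq_abs, abs_mul,
    abs_of_pos (two_pos : (0 : ℝ) < 2)]

lemma integral_zero_pi_of_symm {f : ℝ → ℝ} (hf : IntervalIntegrable f volume 0 (2 * π))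
    (hsymm : ∀ θ, f (2 * π - θ) = f θ) :
    ∫ θ in (0 : ℝ)..π, f θ = (∫ θ in (0 : ℝ)..2 * π, f θ) / 2 := by
  have hpi := pi_pos
  have h1 : IntervalIntegrable f volume 0 π := hf.mono_set (by
    rw [uIcc_of_le hpi.le, uIcc_of_le (by positivity)]; exact Icc_subset_Icc_right (by linarith))
  have h2 : IntervalIntegrable f volume π (2 * π) := hf.mono_set (by
    rw [uIcc_of_le (by linarith), uIcc_of_le (by positivity)]
    exact Icc_subset_Icc_left hpi.le)
  have h3 : ∫ θ in π..2 * π, f θ = ∫ θ in (0 : ℝ)..π, f θ := by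
    have := intervalIntegral.integral_comp_sub_left (a := 0) (b := π) f (2 * π)
    simp only [hsymm, sub_zero] at this
    rw [this]
    congr 1
    ring
  rw [← intervalIntegral.integral_add_adjacent_intervals h1 h2, h3]
  ring

lemma log_abs_mul_cos_sub_ae_eq {t : ℝ} (ht : 0 < t) (x : ℝ) (a : ℂ)
    (ha : a.re = x) (hna : ‖a‖ = t) :
    (fun θ ↦ log |t * cos θ - x|) =ᵐ[volume] fun θ ↦
      log ‖circleMap 0 t θ - a‖ + log ‖circleMap 0 t θ - (starRingEnd ℂ) a‖ - log (2 * t) := by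
  have hnull := (((countable_singleton a).union
    (countable_singleton ((starRingEnd ℂ) a))).preimage_circleMap 0 ht.ne').measure_zero volume
  filter_upwards [measure_eq_zero_iff_ae_notMem.1 hnull] with θ hθ
  simp only [mem_preimage, mem_union, mem_singleton_iff, not_or] at hθ
  have h1 := norm_ne_zero_iff.2 (sub_ne_zero.2 hθ.1)
  have h2 := norm_ne_zero_iff.2 (sub_ne_zero.2 hθ.2)
  have key := two_mul_abs_mul_cos_sub_eq_norm_mul_norm ht x θ a ha hna
  have h0 : |t * cos θ - x| ≠ 0 := by
    intro h
    rw [h, mul_zero, mul_zero] at key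
    exact mul_ne_zero h1 h2 key.symm
  rw [← log_mul h1 h2, ← key, ← mul_assoc, mul_comm t 2, log_mul (by positivity) h0]
  ring

lemma intervalIntegral_log_abs_mul_cos_sub {t x : ℝ} (ht : 0 < t) (hx : |x| ≤ t) :
    IntervalIntegrable (fun θ ↦ log |t * cos θ - x|) volume 0 (2 * π) ∧
      ∫ θ in (0 : ℝ)..2 * π, log |t * cos θ - x| = 2 * π * log (t / 2) := by
  have hsq : x ^ 2 ≤ t ^ 2 := sq_le_sq' (by linarith [neg_abs_le x]) ((le_abs_self x).trans hx)
  set a : ℂ := ⟨x, √(t ^ 2 - x ^ 2)⟩ with ha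
  have hna : ‖a‖ = t := by
    rw [← sq_eq_sq₀ (norm_nonneg _) ht.le, ← Complex.normSq_eq_norm_sq, Complex.normSq_apply]
    simp only [ha]
    rw [mul_self_sqrt (by linarith)]
    ring
  have hi : ∀ b : ℂ, IntervalIntegrable (fun θ ↦ log ‖circleMap 0 t θ - b‖) volume 0 (2 * π) :=
    fun b ↦ circleIntegrable_log_norm_sub_const (c := 0) (a := b) t
  have hv : ∀ b : ℂ, ‖b‖ = t → ∫ θ in (0 : ℝ)..2 * π, log ‖circleMap 0 t θ - b‖
      = 2 * π * log t := by
    intro b hb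
    have := circleAverage_log_norm_sub_const_of_mem_closedBall (a := b) (c := 0) (R := t)
      (by simp [hb, abs_of_pos ht])
    rw [circleAverage_def, smul_eq_mul] at this
    rw [← this]
    field_simp
  have hae := log_abs_mul_cos_sub_ae_eq ht x a rfl hna
  have hI := (((hi a).add (hi ((starRingEnd ℂ) a))).sub
    (intervalIntegrable_const (c := log (2 * t))))
  refine ⟨hI.congr_ae (ae_restrict_of_ae hae.symm), ?_⟩
  rw [intervalIntegral.integral_congr_ae (hae.mono fun θ h _ ↦ h),
    intervalIntegral.integral_sub ((hi a).add (hi _)) intervalIntegrable_const,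
    intervalIntegral.integral_add (hi a) (hi _), hv a hna, hv _ (by simpa using hna),
    intervalIntegral.integral_const, log_mul two_ne_zero ht.ne', log_div ht.ne' two_ne_zero,
    smul_eq_mul]
  ring

/-- The uniform probability measure on the angles `(0, π)`. -/
def angleMeasure : Measure ℝ := ENNReal.ofReal π⁻¹ • volume.restrict (Ioo 0 π)

/-- The probability measure on `(0, 1)` with density `p t ^ (p - 1)`. -/
def radialMeasure (p : ℝ) : Measure ℝ :=
  (volume.restrict (Ioo 0 1)).withDensity fun t ↦ ENNReal.ofReal (p * t ^ (p - 1))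

instance : IsProbabilityMeasure angleMeasure := ⟨by
  rw [angleMeasure, Measure.smul_apply, Measure.restrict_apply_univ, volume_Ioo, sub_zero,
    smul_eq_mul, ← ENNReal.ofReal_mul (by positivity), inv_mul_cancel₀ pi_ne_zero,
    ENNReal.ofReal_one]⟩

/-- The kernel `log 2 - log |u|`, nonnegative for `|u| ≤ 2`, with values in `ℝ≥0∞`. -/
def logKernel (u : ℝ) : ℝ≥0∞ := ENNReal.ofReal (log 2 - log |u|)

@[fun_prop]
lemma measurable_logKernel : Measurable logKernel := by
  unfold logKernel
  fun_prop

lemma log_abs_le_log_two {u : ℝ} (hu : |u| ≤ 2) : log |u| ≤ log 2 := by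
  rcases eq_or_ne u 0 with rfl | h
  · simpa using log_nonneg one_le_two
  · exact log_le_log (abs_pos.2 h) hu

lemma lintegral_logKernel_mul_cos_sub {t x : ℝ} (ht : 0 < t) (ht1 : t ≤ 1) (hx : |x| ≤ t) :
    ∫⁻ θ, logKernel (t * cos θ - x) ∂angleMeasure = ENNReal.ofReal (2 * log 2 - log t) := by
  obtain ⟨hi, hv⟩ := intervalIntegral_log_abs_mul_cos_sub ht hx
  have hi' : IntervalIntegrable (fun θ ↦ log 2 - log |t * cos θ - x|) volume 0 (2 * π) :=
    intervalIntegrable_const.sub hi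
  have hv' : ∫ θ in (0 : ℝ)..π, (log 2 - log |t * cos θ - x|) = π * (2 * log 2 - log t) := by
    rw [integral_zero_pi_of_symm hi' (by simp [cos_two_pi_sub]),
      intervalIntegral.integral_sub intervalIntegrable_const hi, hv,
      intervalIntegral.integral_const, log_div ht.ne' two_ne_zero, smul_eq_mul]
    ring
  have hi'' : IntegrableOn (fun θ ↦ log 2 - log |t * cos θ - x|) (Ioo 0 π) :=
    ((intervalIntegrable_iff_integrableOn_Ioo_of_le (by positivity)).1 hi').mono_set
      (Ioo_subset_Ioo_right (by linarith [pi_pos]))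
  have hle : ∀ θ, |t * cos θ - x| ≤ 2 := fun θ ↦ by
    have h1 : |t * cos θ| ≤ 1 := by
      rw [abs_mul, abs_of_pos ht]
      exact mul_le_one₀ ht1 (abs_nonneg _) (abs_cos_le_one θ)
    linarith [abs_sub (t * cos θ) x]
  rw [angleMeasure, lintegral_smul_measure]
  simp only [logKernel]
  rw [← ofReal_integral_eq_lintegral_ofReal hi''
    (.of_forall fun θ ↦ sub_nonneg.2 (log_abs_le_log_two (hle θ))), ← integral_Ioc_eq_integral_Ioo,
    ← intervalIntegral.integral_of_le pi_pos.le, hv', smul_eq_mul,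
    ← ENNReal.ofReal_mul (by positivity), inv_mul_cancel_left₀ pi_ne_zero]

lemma lintegral_lintegral_logKernel {t s : ℝ} (ht : t ∈ Ioo (0 : ℝ) 1) (hs : s ∈ Ioo (0 : ℝ) 1) :
    ∫⁻ θ, ∫⁻ φ, logKernel (t * cos θ - s * cos φ) ∂angleMeasure ∂angleMeasure =
      ENNReal.ofReal (2 * log 2 - log (max t s)) := by
  wlog h : s ≤ t generalizing t s
  · rw [lintegral_lintegral_swap (by fun_prop), max_comm, ← this hs ht (le_of_not_ge h)]
    simp only [logKernel, abs_sub_comm]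
  · rw [lintegral_lintegral_swap (by fun_prop), max_eq_left h]
    have : ∀ φ, ∫⁻ θ, logKernel (t * cos θ - s * cos φ) ∂angleMeasure =
        ENNReal.ofReal (2 * log 2 - log t) := fun φ ↦
      lintegral_logKernel_mul_cos_sub ht.1 ht.2.le (by
        rw [abs_mul, abs_of_pos hs.1]
        exact (mul_le_of_le_one_right hs.1.le (abs_cos_le_one φ)).trans h)
    simp [this]

lemma lintegral_radialMeasure (p : ℝ) (hp : 0 < p) {f : ℝ → ℝ}
    (hf : IntervalIntegrable (fun t ↦ p * t ^ (p - 1) * f t) volume 0 1)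
    (hf0 : ∀ t ∈ Ioo (0 : ℝ) 1, 0 ≤ f t) :
    ∫⁻ t, ENNReal.ofReal (f t) ∂radialMeasure p =
      ENNReal.ofReal (∫ t in (0 : ℝ)..1, p * t ^ (p - 1) * f t) := by
  have hnn : ∀ t ∈ Ioo (0 : ℝ) 1, 0 ≤ p * t ^ (p - 1) := fun t ht ↦
    mul_nonneg hp.le (rpow_nonneg ht.1.le _)
  rw [radialMeasure, lintegral_withDensity_eq_lintegral_mul_non_measurable _ (by fun_prop)
      (.of_forall fun _ ↦ ENNReal.ofReal_lt_top),
    intervalIntegral.integral_of_le zero_le_one, integral_Ioc_eq_integral_Ioo,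
    ofReal_integral_eq_lintegral_ofReal
      ((intervalIntegrable_iff_integrableOn_Ioo_of_le zero_le_one).1 hf)
      (ae_restrict_of_forall_mem measurableSet_Ioo fun t ht ↦ mul_nonneg (hnn t ht) (hf0 t ht))]
  refine setLIntegral_congr_fun measurableSet_Ioo fun t ht ↦ ?_
  simp only [Pi.mul_apply]
  rw [← ENNReal.ofReal_mul (hnn t ht)]

lemma ae_radialMeasure_mem_Ioo (p : ℝ) : ∀ᵐ t ∂radialMeasure p, t ∈ Ioo (0 : ℝ) 1 :=
  (withDensity_absolutelyContinuous _ _).ae_le (ae_restrict_mem measurableSet_Ioo)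

lemma intervalIntegrable_mul_rpow_sub_one {p : ℝ} (hp : 0 < p) (a b : ℝ) :
    IntervalIntegrable (fun s ↦ p * s ^ (p - 1)) volume a b :=
  (intervalIntegral.intervalIntegrable_rpow' (by linarith)).const_mul p

lemma integral_mul_rpow_sub_one {p : ℝ} (hp : 0 < p) (a b : ℝ) :
    ∫ s in a..b, p * s ^ (p - 1) = b ^ p - a ^ p := by
  rw [intervalIntegral.integral_const_mul, integral_rpow (.inl (by linarith)), sub_add_cancel]
  field_simp

lemma isProbabilityMeasure_radialMeasure {p : ℝ} (hp : 0 < p) :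
    IsProbabilityMeasure (radialMeasure p) := ⟨by
  have := lintegral_radialMeasure p hp (f := fun _ ↦ 1)
    (by simpa using intervalIntegrable_mul_rpow_sub_one hp 0 1) (by simp)
  simpa [integral_mul_rpow_sub_one hp, zero_rpow hp.ne',
    -intervalIntegral.integral_const_mul] using this⟩

lemma integral_radial_log_max {p t : ℝ} (hp : 0 < p) (ht : t ∈ Ioo (0 : ℝ) 1) (c : ℝ) :
    IntervalIntegrable (fun s ↦ p * s ^ (p - 1) * (c - log (max t s))) volume 0 1 ∧
    ∫ s in (0 : ℝ)..1, p * s ^ (p - 1) * (c - log (max t s)) = c + (1 - t ^ p) / p := by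
  have e1 : EqOn (fun s ↦ p * s ^ (p - 1) * (c - log t))
      (fun s ↦ p * s ^ (p - 1) * (c - log (max t s))) (uIcc 0 t) := fun s hs ↦ by
    rw [uIcc_of_le ht.1.le] at hs
    simp only [max_eq_left hs.2]
  have e2 : EqOn (fun s ↦ p * s ^ (p - 1) * (c - log s))
      (fun s ↦ p * s ^ (p - 1) * (c - log (max t s))) (uIcc t 1) := fun s hs ↦ by
    rw [uIcc_of_le ht.2.le] at hs
    simp only [max_eq_right hs.1]
  have hpos : ∀ s ∈ uIcc t 1, 0 < s := fun s hs ↦ by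
    rw [uIcc_of_le ht.2.le] at hs
    exact ht.1.trans_le hs.1
  have i1 := (intervalIntegrable_mul_rpow_sub_one hp 0 t).mul_const (c - log t)
  have i2 : IntervalIntegrable (fun s ↦ p * s ^ (p - 1) * (c - log s)) volume t 1 := by
    refine ContinuousOn.intervalIntegrable fun s hs ↦ ContinuousAt.continuousWithinAt ?_
    have := (hpos s hs).ne'
    exact (continuousAt_const.mul (continuousAt_id.rpow_const (.inl this))).mul
      (continuousAt_const.sub (continuousAt_log this))
  have v2 : ∫ s in t..1, p * s ^ (p - 1) * (c - log s) =
      (c + 1 / p) - (t ^ p * (c - log t) + t ^ p / p) := by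
    rw [intervalIntegral.integral_eq_sub_of_hasDerivAt
      (f := fun s ↦ s ^ p * (c - log s) + s ^ p / p) (fun s hs ↦ ?_) i2]
    · simp
    · have h0 := hpos s hs
      have h1 := hasDerivAt_rpow_const (p := p) (.inl h0.ne')
      refine ((h1.mul ((hasDerivAt_log h0.ne').const_sub c)).add (h1.div_const p)).congr_deriv ?_
      rw [rpow_sub_one h0.ne']
      field_simp
      ring
  have j1 := i1.congr (e1.mono uIoc_subset_uIcc)
  have j2 := i2.congr (e2.mono uIoc_subset_uIcc)
  refine ⟨j1.trans j2, ?_⟩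
  rw [← intervalIntegral.integral_add_adjacent_intervals j1 j2,
    ← intervalIntegral.integral_congr e1, ← intervalIntegral.integral_congr e2, v2,
    intervalIntegral.integral_mul_const, integral_mul_rpow_sub_one hp, zero_rpow hp.ne']
  ring

lemma lintegral_lintegral_radial_log_max {p : ℝ} (hp : 0 < p) :
    ∫⁻ t, ∫⁻ s, ENNReal.ofReal (2 * log 2 - log (max t s)) ∂radialMeasure p ∂radialMeasure p =
      ENNReal.ofReal (2 * log 2 + 1 / (2 * p)) := by
  have hlog2 : 0 ≤ 2 * log 2 := by positivity
  have h1 : ∀ᵐ t ∂radialMeasure p,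
      ∫⁻ s, ENNReal.ofReal (2 * log 2 - log (max t s)) ∂radialMeasure p =
        ENNReal.ofReal (2 * log 2 + (1 - t ^ p) / p) := by
    filter_upwards [ae_radialMeasure_mem_Ioo p] with t ht
    obtain ⟨hi, hv⟩ := integral_radial_log_max hp ht (2 * log 2)
    rw [lintegral_radialMeasure p hp hi fun s hs ↦ ?_, hv]
    have : log (max t s) ≤ 0 :=
      log_nonpos (ht.1.le.trans (le_max_left t s)) (max_le ht.2.le hs.2.le)
    linarith
  have hd : EqOn (fun t ↦ (2 * log 2 + 1 / p) * (p * t ^ (p - 1)) -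
      1 / (2 * p) * (2 * p * t ^ (2 * p - 1)))
      (fun t ↦ p * t ^ (p - 1) * (2 * log 2 + (1 - t ^ p) / p)) (uIoc 0 1) := by
    intro t ht
    rw [uIoc_of_le zero_le_one] at ht
    have : t ^ (2 * p - 1) = t ^ (p - 1) * t ^ p := by
      rw [← rpow_add ht.1]
      congr 1
      ring
    simp only [this]
    field_simp
    ring
  have i1 := (intervalIntegrable_mul_rpow_sub_one hp 0 1).const_mul (2 * log 2 + 1 / p)
  have i2 := (intervalIntegrable_mul_rpow_sub_one (p := 2 * p) (by positivity) 0 1).const_mul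
    (1 / (2 * p))
  rw [lintegral_congr_ae h1, lintegral_radialMeasure p hp ((i1.sub i2).congr hd),
    ← intervalIntegral.integral_congr_ae (.of_forall fun t ht ↦ hd ht), intervalIntegral.integral_sub i1 i2,
    intervalIntegral.integral_const_mul, intervalIntegral.integral_const_mul (1 / (2 * p)),
    integral_mul_rpow_sub_one hp, integral_mul_rpow_sub_one (by positivity), one_rpow, one_rpow,
    zero_rpow hp.ne', zero_rpow (by positivity)]
  · congr 1
    field_simp
    ring
  · intro t ht
    have : t ^ p ≤ 1 := rpow_le_one ht.1.le ht.2.le hp.le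
    have : 0 ≤ (1 - t ^ p) / p := div_nonneg (by linarith) hp.le
    linarith

/-- The integrand of the Ullman density, extended by zero to `t ≤ |x|`. -/
def ullmanKernel (p x t : ℝ) : ℝ≥0∞ :=
  if |x| < t then ENNReal.ofReal (p / π * (t ^ (p - 1) / √(t ^ 2 - x ^ 2))) else 0

/-- The Ullman density with values in `ℝ≥0∞`. -/
def ennrealUllmanDensity (p x : ℝ) : ℝ≥0∞ := ∫⁻ t in Ioo 0 1, ullmanKernel p x t

@[fun_prop]
lemma measurable_uncurry_ullmanKernel (p : ℝ) :
    Measurable fun q : ℝ × ℝ ↦ ullmanKernel p q.1 q.2 := by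
  unfold ullmanKernel
  exact Measurable.ite (measurableSet_lt (by fun_prop) (by fun_prop)) (by fun_prop) (by fun_prop)

@[fun_prop]
lemma measurable_ennrealUllmanDensity (p : ℝ) : Measurable (ennrealUllmanDensity p) :=
  (measurable_uncurry_ullmanKernel p).lintegral_prod_right'

lemma ullmanDensity_eq_toReal {p : ℝ} (hp : 0 < p) {x : ℝ} (hx : |x| ≤ 1) :
    ullmanDensity p x = (ennrealUllmanDensity p x).toReal := by
  have hk : ullmanKernel p x = (Ioi |x|).indicator fun t ↦
      ENNReal.ofReal (p / π * (t ^ (p - 1) / √(t ^ 2 - x ^ 2))) := by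
    ext t
    simp [ullmanKernel, indicator_apply]
  have hset : Ioi |x| ∩ Ioo 0 1 = Ioo |x| 1 := by
    ext t
    simp only [mem_inter_iff, mem_Ioi, mem_Ioo]
    exact ⟨fun h ↦ ⟨h.1, h.2.2⟩, fun h ↦ ⟨h.1, (abs_nonneg x).trans_lt h.1, h.2⟩⟩
  rw [ullmanDensity, if_pos hx, ennrealUllmanDensity, hk, lintegral_indicator measurableSet_Ioi,
    Measure.restrict_restrict measurableSet_Ioi, hset, ← integral_const_mul,
    integral_eq_lintegral_of_nonneg_ae _
      (by apply Measurable.aestronglyMeasurable; fun_prop)]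
  refine ae_restrict_of_forall_mem measurableSet_Ioo fun t ht ↦ ?_
  have : 0 ≤ t := (abs_nonneg x).trans ht.1.le
  simp only [Pi.zero_apply]
  positivity

lemma image_mul_cos_Ioo {t : ℝ} (ht : 0 < t) : (fun θ ↦ t * cos θ) '' Ioo 0 π = Ioo (-t) t := by
  ext x
  constructor
  · rintro ⟨θ, hθ, rfl⟩
    have h1 : cos θ < 1 := by
      simpa using strictAntiOn_cos (left_mem_Icc.2 pi_pos.le) (Ioo_subset_Icc_self hθ) hθ.1
    have h2 : -1 < cos θ := by
      simpa using strictAntiOn_cos (Ioo_subset_Icc_self hθ) (right_mem_Icc.2 pi_pos.le) hθ.2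
    constructor <;> simp only <;> nlinarith
  · rintro ⟨h1, h2⟩
    have h3 : -1 < x / t := by rw [lt_div_iff₀ ht]; linarith
    have h4 : x / t < 1 := by rw [div_lt_iff₀ ht]; linarith
    refine ⟨arccos (x / t), ⟨arccos_pos.2 h4, (arccos_lt_pi).2 h3⟩, ?_⟩
    simp only
    rw [cos_arccos h3.le h4.le]
    field_simp

lemma setLIntegral_Ioo_eq_angle {t : ℝ} (ht : 0 < t) (f : ℝ → ℝ≥0∞) :
    ∫⁻ x in Ioo (-t) t, ENNReal.ofReal (1 / √(t ^ 2 - x ^ 2)) * f x =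
      ∫⁻ θ in Ioo 0 π, f (t * cos θ) := by
  rw [← image_mul_cos_Ioo ht, lintegral_image_eq_lintegral_abs_deriv_mul measurableSet_Ioo
    (f' := fun θ ↦ t * -sin θ)
    (fun θ _ ↦ ((hasDerivAt_cos θ).const_mul t).hasDerivWithinAt)
    (fun a ha b hb h ↦ injOn_cos (Ioo_subset_Icc_self ha) (Ioo_subset_Icc_self hb)
      (mul_left_cancel₀ ht.ne' h))]
  refine setLIntegral_congr_fun measurableSet_Ioo fun θ hθ ↦ ?_
  have hs := sin_pos_of_mem_Ioo hθ
  have hsq : t ^ 2 - (t * cos θ) ^ 2 = (t * sin θ) ^ 2 := by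
    linear_combination (-t ^ 2) * sin_sq_add_cos_sq θ
  rw [hsq, sqrt_sq (by positivity), mul_neg, abs_neg, abs_of_pos (by positivity), ← mul_assoc,
    ← ENNReal.ofReal_mul (by positivity), mul_one_div_cancel (by positivity), ENNReal.ofReal_one,
    one_mul]

lemma setLIntegral_ullmanKernel_mul {p t : ℝ} (hp : 0 < p) (ht : t ∈ Ioo (0 : ℝ) 1)
    {f : ℝ → ℝ≥0∞} (hf : Measurable f) :
    ∫⁻ x in Icc (-1) 1, ullmanKernel p x t * f x =
      ENNReal.ofReal (p * t ^ (p - 1)) * ∫⁻ θ, f (t * cos θ) ∂angleMeasure := by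
  have ht0 := ht.1
  have hk : (fun x ↦ ullmanKernel p x t * f x) = (Ioo (-t) t).indicator fun x ↦
      ENNReal.ofReal (p * t ^ (p - 1)) * (ENNReal.ofReal π⁻¹ *
        (ENNReal.ofReal (1 / √(t ^ 2 - x ^ 2)) * f x)) := by
    ext x
    simp only [ullmanKernel, indicator_apply, mem_Ioo, ← abs_lt]
    split_ifs
    · rw [← mul_assoc, ← mul_assoc, ← ENNReal.ofReal_mul (by positivity),
        ← ENNReal.ofReal_mul (by positivity)]
      congr 2
      ring
    · rw [zero_mul]
  have hset : Ioo (-t) t ∩ Icc (-1) 1 = Ioo (-t) t :=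
    inter_eq_left.2 fun x hx ↦ ⟨by linarith [hx.1, ht.2], by linarith [hx.2, ht.2]⟩
  rw [hk, lintegral_indicator measurableSet_Ioo, Measure.restrict_restrict measurableSet_Ioo, hset,
    lintegral_const_mul _ (by fun_prop), lintegral_const_mul _ (by fun_prop),
    setLIntegral_Ioo_eq_angle ht0, angleMeasure, lintegral_smul_measure, smul_eq_mul]

/-- The probability measure on `[-1, 1]` whose density is the Ullman density. -/
def ullmanMeasure (p : ℝ) : Measure ℝ :=
  (volume.restrict (Icc (-1) 1)).withDensity (ennrealUllmanDensity p)

lemma lintegral_ullmanMeasure {p : ℝ} (hp : 0 < p) {f : ℝ → ℝ≥0∞} (hf : Measurable f) :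
    ∫⁻ x, f x ∂ullmanMeasure p = ∫⁻ t, ∫⁻ θ, f (t * cos θ) ∂angleMeasure ∂radialMeasure p := by
  have hm : Measurable fun t ↦ ∫⁻ θ, f (t * cos θ) ∂angleMeasure :=
    Measurable.lintegral_prod_right' (f := fun q : ℝ × ℝ ↦ f (q.1 * cos q.2)) (by fun_prop)
  rw [ullmanMeasure, lintegral_withDensity_eq_lintegral_mul _ (by fun_prop) hf, radialMeasure,
    lintegral_withDensity_eq_lintegral_mul _ (by fun_prop) hm]
  have h1 : ∀ x, (ennrealUllmanDensity p * f) x = ∫⁻ t in Ioo 0 1, ullmanKernel p x t * f x :=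
    fun x ↦ (lintegral_mul_const _
      ((measurable_uncurry_ullmanKernel p).comp (measurable_prodMk_left (x := x)))).symm
  simp only [h1]
  rw [lintegral_lintegral_swap (by fun_prop)]
  exact setLIntegral_congr_fun measurableSet_Ioo fun t ht ↦
    setLIntegral_ullmanKernel_mul hp ht hf

lemma isProbabilityMeasure_ullmanMeasure {p : ℝ} (hp : 0 < p) :
    IsProbabilityMeasure (ullmanMeasure p) := ⟨by
  have := isProbabilityMeasure_radialMeasure hp
  simpa using lintegral_ullmanMeasure hp (f := fun _ ↦ 1) measurable_const⟩

lemma ae_ullmanMeasure_mem_Icc (p : ℝ) : ∀ᵐ x ∂ullmanMeasure p, x ∈ Icc (-1 : ℝ) 1 :=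
  (withDensity_absolutelyContinuous _ _).ae_le (ae_restrict_mem measurableSet_Icc)

lemma integral_ullmanMeasure {p : ℝ} (hp : 0 < p) (f : ℝ → ℝ) :
    ∫ x, f x ∂ullmanMeasure p = ∫ x in Icc (-1 : ℝ) 1, ullmanDensity p x * f x := by
  have hfin : ∫⁻ x in Icc (-1) 1, ennrealUllmanDensity p x ≠ ∞ := by
    have := (isProbabilityMeasure_ullmanMeasure hp).measure_univ
    rw [ullmanMeasure, withDensity_apply _ MeasurableSet.univ, Measure.restrict_univ] at this
    simp [this]
  rw [ullmanMeasure, integral_withDensity_eq_integral_toReal_smul (by fun_prop)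
    (ae_lt_top (by fun_prop) hfin)]
  refine setIntegral_congr_fun measurableSet_Icc fun x hx ↦ ?_
  simp only [smul_eq_mul]
  rw [ullmanDensity_eq_toReal hp (abs_le.2 hx)]

lemma lintegral_lintegral_ullmanMeasure_logKernel {p : ℝ} (hp : 0 < p) :
    ∫⁻ x, ∫⁻ y, logKernel (x - y) ∂ullmanMeasure p ∂ullmanMeasure p =
      ENNReal.ofReal (2 * log 2 + 1 / (2 * p)) := by
  have := isProbabilityMeasure_ullmanMeasure hp
  have := isProbabilityMeasure_radialMeasure hp
  have hm : Measurable fun x ↦ ∫⁻ y, logKernel (x - y) ∂ullmanMeasure p :=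
    Measurable.lintegral_prod_right' (f := fun q : ℝ × ℝ ↦ logKernel (q.1 - q.2)) (by fun_prop)
  rw [lintegral_ullmanMeasure hp hm, ← lintegral_lintegral_radial_log_max hp]
  refine lintegral_congr_ae ?_
  filter_upwards [ae_radialMeasure_mem_Ioo p] with t ht
  have h1 : ∀ θ, ∫⁻ y, logKernel (t * cos θ - y) ∂ullmanMeasure p =
      ∫⁻ s, ∫⁻ φ, logKernel (t * cos θ - s * cos φ) ∂angleMeasure ∂radialMeasure p :=
    fun θ ↦ lintegral_ullmanMeasure hp (by fun_prop)
  simp only [h1]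
  have hm' : Measurable fun q : ℝ × ℝ ↦
      ∫⁻ φ, logKernel (t * cos q.1 - q.2 * cos φ) ∂angleMeasure :=
    Measurable.lintegral_prod_right'
      (f := fun r : (ℝ × ℝ) × ℝ ↦ logKernel (t * cos r.1.1 - r.1.2 * cos r.2)) (by fun_prop)
  rw [lintegral_lintegral_swap hm'.aemeasurable]
  refine lintegral_congr_ae ?_
  filter_upwards [ae_radialMeasure_mem_Ioo p] with s hs
  exact lintegral_lintegral_logKernel ht hs

lemma integral_integral_ullmanMeasure_log {p : ℝ} (hp : 0 < p) :
    ∫ x, ∫ y, log |x - y| ∂ullmanMeasure p ∂ullmanMeasure p = -log 2 - 1 / (2 * p) := by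
  have := isProbabilityMeasure_ullmanMeasure hp
  set μ := (ullmanMeasure p).prod (ullmanMeasure p) with hμ
  have hnn : 0 ≤ᵐ[μ] fun q ↦ log 2 - log |q.1 - q.2| := by
    filter_upwards [Measure.quasiMeasurePreserving_fst.ae (ae_ullmanMeasure_mem_Icc p),
      Measure.quasiMeasurePreserving_snd.ae (ae_ullmanMeasure_mem_Icc p)] with q h1 h2
    refine sub_nonneg.2 (log_abs_le_log_two (abs_le.2 ⟨?_, ?_⟩))
    · linarith [h1.1, h2.2]
    · linarith [h1.2, h2.1]
  have hm : Measurable fun q : ℝ × ℝ ↦ log 2 - log |q.1 - q.2| := by fun_prop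
  have hl : ∫⁻ q, ENNReal.ofReal (log 2 - log |q.1 - q.2|) ∂μ =
      ENNReal.ofReal (2 * log 2 + 1 / (2 * p)) := by
    rw [hμ, lintegral_prod _ hm.ennreal_ofReal.aemeasurable,
      ← lintegral_lintegral_ullmanMeasure_logKernel hp]
    rfl
  have hi : Integrable (fun q : ℝ × ℝ ↦ log 2 - log |q.1 - q.2|) μ :=
    (lintegral_ofReal_ne_top_iff_integrable hm.aestronglyMeasurable hnn).1 (hl ▸ ENNReal.ofReal_ne_top)
  have hv : ∫ q, (log 2 - log |q.1 - q.2|) ∂μ = 2 * log 2 + 1 / (2 * p) := by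
    rw [integral_eq_lintegral_of_nonneg_ae hnn hm.aestronglyMeasurable, hl,
      ENNReal.toReal_ofReal (by positivity)]
  have hi' : Integrable (fun q : ℝ × ℝ ↦ log |q.1 - q.2|) μ := 
    ((integrable_const (log 2)).sub hi).congr (.of_forall fun q ↦ sub_sub_cancel _ _)
  rw [integral_sub (integrable_const _) hi', integral_const, probReal_univ, one_smul] at hv
  rw [integral_integral hi']
  linarith

theorem stmt16 (p : ℝ) (hp : 0 < p) :
    (∫ x in Set.Icc (-1 : ℝ) 1, ∫ y in Set.Icc (-1 : ℝ) 1,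
        ullmanDensity p x * ullmanDensity p y * Real.log |x - y|) =
      -Real.log 2 - 1 / (2 * p) := by
  rw [← integral_integral_ullmanMeasure_log hp, integral_ullmanMeasure hp]
  simp only [integral_ullmanMeasure hp, mul_assoc, integral_const_mul]

end
end
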